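/- arXiv:math/9301202 — 4 statements merged into one kernel-verified Lean document; each statement's English description precedes it below -/
import Mathlib

section
/- The first Rogers–Ramanujan identity: the number of partitions of a positive integer N into parts congruent to 1 or 4 modulo 5 equals the number of partitions of N into parts that pairwise differ by at least 2. -/
open Finset

section GaussianBinomial

variable {R : Type*} [CommRing R]

/-- The Gaussian binomial coefficient at `q`, with an integer lower index. -/
def gaussBinom (q : R) : ℕ → ℤ → R
  | 0, k => if k = 0 then 1 else 0
  | n + 1, k => gaussBinom q n (k - 1) + q ^ k.toNat * gaussBinom q n k

theorem gaussBinom_of_neg (q : R) (n : ℕ) {k : ℤ} (hk : k < 0) : gaussBinom q n k = 0 := by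
  induction n generalizing k with
  | zero => simp [gaussBinom, hk.ne]
  | succ n ih => rw [gaussBinom, ih hk, ih (by lia)]; simp

theorem gaussBinom_of_lt (q : R) {n : ℕ} {k : ℤ} (hk : n < k) : gaussBinom q n k = 0 := by
  induction n generalizing k with
  | zero => simp only [gaussBinom]; rw [if_neg (by lia)]
  | succ n ih => rw [gaussBinom, ih (by lia), ih (by lia)]; simp

theorem map_gaussBinom {S : Type*} [CommRing S] (f : R →+* S) (q : R) (n : ℕ) (k : ℤ) :
    f (gaussBinom q n k) = gaussBinom (f q) n k := by
  induction n generalizing k with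
  | zero => simp only [gaussBinom]; split_ifs <;> simp
  | succ n ih => simp [gaussBinom, ih]

/-- The `q`-Pochhammer symbol `(q; q)_n`. -/
def qFactorial (q : R) (n : ℕ) : R := ∏ i ∈ range n, (1 - q ^ (i + 1))

theorem qFactorial_succ (q : R) (n : ℕ) :
    qFactorial q (n + 1) = qFactorial q n * (1 - q ^ (n + 1)) := prod_range_succ _ _

theorem gaussBinom_zero_right (q : R) (n : ℕ) : gaussBinom q n 0 = 1 := by
  induction n with
  | zero => simp [gaussBinom]
  | succ n ih => rw [gaussBinom, ih, gaussBinom_of_neg _ _ (by lia)]; simp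

theorem gaussBinom_self (q : R) (n : ℕ) : gaussBinom q n n = 1 := by
  induction n with
  | zero => simp [gaussBinom]
  | succ n ih => rw [gaussBinom, gaussBinom_of_lt (k := ((n + 1 : ℕ) : ℤ)) _ (by lia)]; simpa

theorem gaussBinom_mul_qFactorial (q : R) (a b : ℕ) :
    gaussBinom q (a + b) a * (qFactorial q a * qFactorial q b) = qFactorial q (a + b) := by
  induction a generalizing b with
  | zero => simp [gaussBinom_zero_right, qFactorial]
  | succ a iha =>
    induction b with
    | zero => rw [add_zero, gaussBinom_self]; simp [qFactorial]
    | succ b ihb =>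
      have h₁ := iha (b + 1)
      rw [show a + 1 + b = a + b + 1 by ring] at ihb
      rw [← add_assoc] at h₁
      rw [show a + 1 + (b + 1) = a + b + 1 + 1 by ring, gaussBinom, qFactorial_succ q (a + b + 1)]
      rw [show ((a + 1 : ℕ) : ℤ) - 1 = a by push_cast; ring, Int.toNat_natCast]
      rw [qFactorial_succ q b] at h₁ ⊢
      rw [qFactorial_succ q a] at ihb ⊢
      have e : q ^ (a + b + 1 + 1) = q ^ (a + 1) * q ^ (b + 1) := by ring
      rw [e]
      linear_combination (1 - q ^ (a + 1)) * h₁ + q ^ (a + 1) * (1 - q ^ (b + 1)) * ihb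

theorem hasFiniteSupport_mul_gaussBinom (q : R) (n : ℕ) (a : ℤ) {b : ℤ} (hb : b ≠ 0) (c : ℤ → R) :
    Function.HasFiniteSupport fun i : ℤ ↦ c i * gaussBinom q n (a + b * i) := by
  have hinj : Function.Injective fun i : ℤ ↦ a + b * i := fun i j h ↦ by simpa [hb] using h
  refine ((Set.finite_Icc (0 : ℤ) n).preimage hinj.injOn).subset fun i hi ↦ ?_
  simp only [Set.mem_preimage, Set.mem_Icc]
  by_contra h
  rw [not_and_or, not_le, not_le] at h
  rcases h with h | h
  · simp [gaussBinom_of_neg _ _ h] at hi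
  · simp [gaussBinom_of_lt _ h] at hi

end GaussianBinomial

section Field

variable {K : Type*} [Field K] {q : K}

theorem gaussBinom_succ_zpow (n : ℕ) (k : ℤ) :
    gaussBinom q (n + 1) k = gaussBinom q n (k - 1) + q ^ k * gaussBinom q n k := by
  rcases lt_or_ge k 0 with hk | hk
  · simp [gaussBinom_of_neg _ _ hk, gaussBinom_of_neg _ _ (show k - 1 < 0 by lia)]
  · lift k to ℕ using hk
    simp [gaussBinom]

theorem gaussBinom_succ_zpow' (hq : q ≠ 0) (n : ℕ) (k : ℤ) :
    gaussBinom q (n + 1) k = q ^ (n + 1 - k) * gaussBinom q n (k - 1) + gaussBinom q n k := by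
  induction n generalizing k with
  | zero =>
    rw [gaussBinom_succ_zpow]
    simp only [gaussBinom]
    rcases eq_or_ne k 0 with rfl | h0
    · simp
    · rcases eq_or_ne k 1 with rfl | h1
      · simp
      · simp [h0, show k - 1 ≠ 0 by lia]
  | succ n ih =>
    have e₁ : q ^ k * q ^ ((n : ℤ) + 1 - k) = q ^ ((n : ℤ) + 1) := by
      rw [← zpow_add₀ hq]; congr 1; ring
    have e₂ : q ^ ((n : ℤ) + 2 - k) * q ^ (k - 1) = q ^ ((n : ℤ) + 1) := by
      rw [← zpow_add₀ hq]; congr 1; ring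
    have h := gaussBinom_succ_zpow (q := q) (n + 1) k
    have ih' := ih (k - 1)
    rw [show (n : ℤ) + 1 - (k - 1) = n + 2 - k by ring] at ih'
    push_cast
    rw [show (n : ℤ) + 1 + 1 - k = n + 2 - k by ring]
    linear_combination h + ih' + q ^ k * ih k
      - q ^ ((n : ℤ) + 2 - k) * gaussBinom_succ_zpow (q := q) n (k - 1)
      - gaussBinom_succ_zpow (q := q) n k + gaussBinom q n (k - 1) * (e₁ - e₂)

theorem zpow_mul_zpow_of_add_eq (hq : q ≠ 0) {a b c : ℤ} (h : a + b = c) :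
    q ^ a * q ^ b = q ^ c := by rw [← zpow_add₀ hq, h]

theorem zpow_mul_zpow_eq_of_add_eq (hq : q ≠ 0) {a b c d : ℤ} (h : a + b = c + d) :
    q ^ a * q ^ b = q ^ c * q ^ d := by rw [← zpow_add₀ hq, h, zpow_add₀ hq]

theorem finsum_int_add_sub_comp_add_one {f g : ℤ → K} (hf : f.HasFiniteSupport)
    (hg : g.HasFiniteSupport) : ∑ᶠ i, (f i + (g i - g (i + 1))) = ∑ᶠ i, f i := by
  have hg' : Function.HasFiniteSupport fun i ↦ g (i + 1) :=
    Set.Finite.preimage ((Equiv.addRight (1 : ℤ)).injective.injOn) hg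
  rw [finsum_add_distrib hf (hg.fun_sub hg'), finsum_sub_distrib hg hg']
  have h : ∑ᶠ i, g (i + 1) = ∑ᶠ i, g i := finsum_comp_equiv (Equiv.addRight (1 : ℤ))
  rw [h, sub_self, add_zero]

/-- The summand of Schur's expression for the `2m`-th Schur polynomial. -/
def schurEvenTerm (q : K) (m : ℕ) (i : ℤ) : K :=
  q ^ (10 * i ^ 2 + i) * gaussBinom q (2 * m) (m + -5 * i) -
    q ^ (10 * i ^ 2 + 11 * i + 3) * gaussBinom q (2 * m) (m - 3 + -5 * i)

/-- The summand of Schur's expression for the `(2m+1)`-st Schur polynomial. -/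
def schurOddTerm (q : K) (m : ℕ) (i : ℤ) : K :=
  q ^ (10 * i ^ 2 + i) * gaussBinom q (2 * m + 1) (m + -5 * i) -
    q ^ (10 * i ^ 2 + 11 * i + 3) * gaussBinom q (2 * m + 1) (m - 2 + -5 * i)

theorem hasFiniteSupport_schurEvenTerm (q : K) (m : ℕ) : (schurEvenTerm q m).HasFiniteSupport :=
  (hasFiniteSupport_mul_gaussBinom q _ _ (by norm_num) _).fun_sub
    (hasFiniteSupport_mul_gaussBinom q _ _ (by norm_num) _)

theorem hasFiniteSupport_schurOddTerm (q : K) (m : ℕ) : (schurOddTerm q m).HasFiniteSupport :=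
  (hasFiniteSupport_mul_gaussBinom q _ _ (by norm_num) _).fun_sub
    (hasFiniteSupport_mul_gaussBinom q _ _ (by norm_num) _)

theorem schurOddTerm_succ (hq : q ≠ 0) (m : ℕ) (i : ℤ) :
    schurOddTerm q (m + 1) i =
      schurEvenTerm q (m + 1) i + q ^ (2 * m + 2 : ℤ) * schurOddTerm q m i := by
  have h₁ := gaussBinom_succ_zpow' hq (2 * m + 2) (m + 1 + -5 * i)
  have h₂ := gaussBinom_succ_zpow (q := q) (2 * m + 1) (m + -5 * i)
  have h₃ := gaussBinom_succ_zpow (q := q) (2 * m + 2) (m - 1 + -5 * i)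
  have h₄ := gaussBinom_succ_zpow' hq (2 * m + 1) (m - 1 + -5 * i)
  rw [show ((2 * m + 2 : ℕ) : ℤ) + 1 - (m + 1 + -5 * i) = m + 2 + 5 * i by push_cast; ring,
    show (m : ℤ) + 1 + -5 * i - 1 = m + -5 * i by ring] at h₁
  rw [show (m : ℤ) + -5 * i - 1 = m - 1 + -5 * i by ring] at h₂
  rw [show (m : ℤ) - 1 + -5 * i - 1 = m - 2 + -5 * i by ring] at h₃ h₄
  rw [show ((2 * m + 1 : ℕ) : ℤ) + 1 - (m - 1 + -5 * i) = m + 3 + 5 * i by push_cast; ring] at h₄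
  have e₁ : q ^ (m + 2 + 5 * i) * q ^ (m + -5 * i) = q ^ (2 * m + 2 : ℤ) :=
    zpow_mul_zpow_of_add_eq hq (by ring)
  have e₂ : q ^ (m - 1 + -5 * i) * q ^ (m + 3 + 5 * i) = q ^ (2 * m + 2 : ℤ) :=
    zpow_mul_zpow_of_add_eq hq (by ring)
  have e₃ : q ^ (10 * i ^ 2 + i) * q ^ (m + 2 + 5 * i) =
      q ^ (10 * i ^ 2 + 11 * i + 3) * q ^ (m - 1 + -5 * i) :=
    zpow_mul_zpow_eq_of_add_eq hq (by ring)
  simp only [schurOddTerm, schurEvenTerm, show 2 * (m + 1) = 2 * m + 2 by ring]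
  push_cast
  rw [show (m : ℤ) + 1 - 2 = m - 1 by ring, show (m : ℤ) + 1 - 3 = m - 2 by ring]
  linear_combination q ^ (10 * i ^ 2 + i) * (h₁ + q ^ (m + 2 + 5 * i) * h₂)
    - q ^ (10 * i ^ 2 + 11 * i + 3) * (h₃ + q ^ (m - 1 + -5 * i) * h₄)
    + q ^ (10 * i ^ 2 + i) * gaussBinom q (2 * m + 1) (m + -5 * i) * e₁
    - q ^ (10 * i ^ 2 + 11 * i + 3) * gaussBinom q (2 * m + 1) (m - 2 + -5 * i) * e₂
    + gaussBinom q (2 * m + 1) (m - 1 + -5 * i) * e₃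

theorem schurEvenTerm_succ (hq : q ≠ 0) (m : ℕ) (i : ℤ) :
    schurEvenTerm q (m + 1) i = schurOddTerm q m i + q ^ (2 * m + 1 : ℤ) * schurEvenTerm q m i +
      (q ^ (10 * i ^ 2 - 4 * i + m + 1) * gaussBinom q (2 * m) (m + 1 + -5 * i) -
        q ^ (10 * (i + 1) ^ 2 - 4 * (i + 1) + m + 1) *
          gaussBinom q (2 * m) (m + 1 + -5 * (i + 1))) := by
  have h₁ := gaussBinom_succ_zpow (q := q) (2 * m + 1) (m + 1 + -5 * i)
  have h₂ := gaussBinom_succ_zpow' hq (2 * m) (m + 1 + -5 * i)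
  have h₃ := gaussBinom_succ_zpow' hq (2 * m + 1) (m - 2 + -5 * i)
  have h₄ := gaussBinom_succ_zpow (q := q) (2 * m) (m - 3 + -5 * i)
  rw [show (m : ℤ) + 1 + -5 * i - 1 = m + -5 * i by ring] at h₁ h₂
  rw [show ((2 * m : ℕ) : ℤ) + 1 - (m + 1 + -5 * i) = m + 5 * i by push_cast; ring] at h₂
  rw [show ((2 * m + 1 : ℕ) : ℤ) + 1 - (m - 2 + -5 * i) = m + 4 + 5 * i by push_cast; ring,
    show (m : ℤ) - 2 + -5 * i - 1 = m - 3 + -5 * i by ring] at h₃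
  rw [show (m : ℤ) - 3 + -5 * i - 1 = m - 4 + -5 * i by ring] at h₄
  have e₁ : q ^ (m + 1 + -5 * i) * q ^ (m + 5 * i) = q ^ (2 * m + 1 : ℤ) :=
    zpow_mul_zpow_of_add_eq hq (by ring)
  have e₂ : q ^ (m + 4 + 5 * i) * q ^ (m - 3 + -5 * i) = q ^ (2 * m + 1 : ℤ) :=
    zpow_mul_zpow_of_add_eq hq (by ring)
  have e₃ : q ^ (10 * i ^ 2 + i) * q ^ (m + 1 + -5 * i) = q ^ (10 * i ^ 2 - 4 * i + m + 1) :=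
    zpow_mul_zpow_of_add_eq hq (by ring)
  have e₄ : q ^ (10 * i ^ 2 + 11 * i + 3) * q ^ (m + 4 + 5 * i) =
      q ^ (10 * (i + 1) ^ 2 - 4 * (i + 1) + m + 1) :=
    zpow_mul_zpow_of_add_eq hq (by ring)
  simp only [schurOddTerm, schurEvenTerm, show 2 * (m + 1) = 2 * m + 1 + 1 by ring]
  push_cast
  rw [show (m : ℤ) + 1 - 3 = m - 2 by ring,
    show (m : ℤ) + 1 + -5 * (i + 1) = m - 4 + -5 * i by ring]
  linear_combination q ^ (10 * i ^ 2 + i) * (h₁ + q ^ (m + 1 + -5 * i) * h₂)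
    - q ^ (10 * i ^ 2 + 11 * i + 3) * (h₃ + q ^ (m + 4 + 5 * i) * h₄)
    + q ^ (10 * i ^ 2 + i) * gaussBinom q (2 * m) (m + -5 * i) * e₁
    - q ^ (10 * i ^ 2 + 11 * i + 3) * gaussBinom q (2 * m) (m - 3 + -5 * i) * e₂
    + gaussBinom q (2 * m) (m + 1 + -5 * i) * e₃
    - gaussBinom q (2 * m) (m - 4 + -5 * i) * e₄

/-- The Schur polynomials, generating functions of the partitions into parts less than `n` with
pairwise differences at least `2`. -/
def schurPoly {R : Type*} [CommRing R] (q : R) : ℕ → R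
  | 0 => 1
  | 1 => 1
  | n + 2 => schurPoly q (n + 1) + q ^ (n + 1) * schurPoly q n

theorem map_schurPoly {R S : Type*} [CommRing R] [CommRing S] (f : R →+* S) (q : R) (n : ℕ) :
    f (schurPoly q n) = schurPoly (f q) n := by
  induction n using schurPoly.induct with
  | case1 => simp [schurPoly]
  | case2 => simp [schurPoly]
  | case3 n ih ih' => simp [schurPoly, ih, ih']

theorem finsum_schurOddTerm_succ (hq : q ≠ 0) (m : ℕ) :
    ∑ᶠ i, schurOddTerm q (m + 1) i =
      ∑ᶠ i, schurEvenTerm q (m + 1) i + q ^ (2 * m + 2) * ∑ᶠ i, schurOddTerm q m i := by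
  have h := hasFiniteSupport_schurOddTerm q m
  rw [mul_finsum' _ _ h, ← finsum_add_distrib (hasFiniteSupport_schurEvenTerm q _)
    (h.subset fun i hi ↦ right_ne_zero_of_mul hi)]
  exact finsum_congr fun i ↦ mod_cast schurOddTerm_succ hq m i

theorem finsum_schurEvenTerm_succ (hq : q ≠ 0) (m : ℕ) :
    ∑ᶠ i, schurEvenTerm q (m + 1) i =
      ∑ᶠ i, schurOddTerm q m i + q ^ (2 * m + 1) * ∑ᶠ i, schurEvenTerm q m i := by
  have h := hasFiniteSupport_schurEvenTerm q m
  have ho := hasFiniteSupport_schurOddTerm q m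
  have hs := hasFiniteSupport_mul_gaussBinom q (2 * m) (m + 1) (b := -5) (by norm_num)
    fun i ↦ q ^ (10 * i ^ 2 - 4 * i + m + 1)
  have hm : Function.HasFiniteSupport fun i ↦ q ^ (2 * m + 1) * schurEvenTerm q m i :=
    h.subset fun i hi ↦ right_ne_zero_of_mul hi
  rw [mul_finsum' _ _ h, ← finsum_add_distrib ho hm,
    ← finsum_int_add_sub_comp_add_one (ho.fun_add hm) hs]
  exact finsum_congr fun i ↦ mod_cast schurEvenTerm_succ hq m i

theorem schurPoly_eq_finsum (hq : q ≠ 0) (m : ℕ) :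
    schurPoly q (2 * m) = ∑ᶠ i, schurEvenTerm q m i ∧
      schurPoly q (2 * m + 1) = ∑ᶠ i, schurOddTerm q m i := by
  induction m with
  | zero =>
    constructor
    · rw [finsum_eq_single _ 0]
      · simp [schurEvenTerm, schurPoly, gaussBinom]
      · intro i hi
        simp [schurEvenTerm, gaussBinom, hi, show (-3 : ℤ) + -(5 * i) ≠ 0 by lia]
    · rw [finsum_eq_single _ 0]
      · simp [schurOddTerm, schurPoly, gaussBinom]
      · intro i hi
        simp [schurOddTerm, gaussBinom, hi, show (-2 : ℤ) + -(5 * i) ≠ 0 by lia,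
          show (-2 : ℤ) + -(5 * i) - 1 ≠ 0 by lia, show -(5 * i) - 1 ≠ 0 by lia]
  | succ m ih =>
    have h : schurPoly q (2 * (m + 1)) = ∑ᶠ i, schurEvenTerm q (m + 1) i := by
      rw [finsum_schurEvenTerm_succ hq, ← ih.1, ← ih.2]; rfl
    refine ⟨h, ?_⟩
    rw [finsum_schurOddTerm_succ hq, ← h, ← ih.2]; rfl

/-- The coefficient of the theta series `∑ z ^ j * p ^ (j * (j - 1) / 2)`. -/
def thetaTerm (p z : K) (j : ℤ) : K := z ^ j * p ^ (j * (j - 1) / 2)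

theorem thetaTerm_add_one {p z : K} (hp : p ≠ 0) (hz : z ≠ 0) (j : ℤ) :
    thetaTerm p z (j + 1) = thetaTerm p z j * z * p ^ j := by
  have h : (j + 1) * (j + 1 - 1) / 2 = j * (j - 1) / 2 + j := by
    rw [show (j + 1) * (j + 1 - 1) = j * (j - 1) + j * 2 by ring,
      Int.add_mul_ediv_right _ _ two_ne_zero]
  rw [thetaTerm, thetaTerm, h, zpow_add₀ hp, zpow_add_one₀ hz]
  ring

theorem hasFiniteSupport_thetaTerm_mul (p z : K) (n : ℕ) (a : ℤ) :
    Function.HasFiniteSupport fun j ↦ thetaTerm p z j * gaussBinom p n (a + 1 * j) :=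
  hasFiniteSupport_mul_gaussBinom p n a one_ne_zero _

theorem finsum_thetaTerm_odd {p z : K} (hp : p ≠ 0) (hz : z ≠ 0) (n : ℕ) :
    ∑ᶠ j, thetaTerm p z j * gaussBinom p (2 * n + 1) (n + 1 * j) =
      (1 + z * p ^ n) * ∑ᶠ j, thetaTerm p z j * gaussBinom p (2 * n) (n + 1 * j) := by
  have h := hasFiniteSupport_thetaTerm_mul p z (2 * n) n
  have hs := hasFiniteSupport_mul_gaussBinom p (2 * n) (n - 1) (b := 1) one_ne_zero
    fun j ↦ thetaTerm p z j * p ^ (n + 1 - j : ℤ)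
  rw [mul_finsum' _ _ h, ← finsum_int_add_sub_comp_add_one
    (h.subset fun i hi ↦ right_ne_zero_of_mul hi) hs]
  refine finsum_congr fun j ↦ ?_
  have h₁ := gaussBinom_succ_zpow' hp (2 * n) (n + 1 * j)
  rw [show ((2 * n : ℕ) : ℤ) + 1 - (n + 1 * j) = n + 1 - j by push_cast; ring,
    show (n : ℤ) + 1 * j - 1 = n - 1 + 1 * j by ring] at h₁
  rw [h₁, thetaTerm_add_one hp hz, show (n : ℤ) + 1 - (j + 1) = n - j by ring,
    show (n : ℤ) - 1 + 1 * (j + 1) = n + 1 * j by ring]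
  have e : p ^ j * p ^ (n - j : ℤ) = p ^ n := by
    rw [zpow_mul_zpow_of_add_eq hp (add_sub_cancel j (n : ℤ)), zpow_natCast]
  linear_combination thetaTerm p z j * z * gaussBinom p (2 * n) (n + 1 * j) * e

theorem finsum_thetaTerm_even {p z : K} (hp : p ≠ 0) (hz : z ≠ 0) (n : ℕ) :
    ∑ᶠ j, thetaTerm p z j * gaussBinom p (2 * n + 2) (n + 1 + 1 * j) =
      (1 + z⁻¹ * p ^ (n + 1)) *
        ∑ᶠ j, thetaTerm p z j * gaussBinom p (2 * n + 1) (n + 1 * j) := by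
  have h := hasFiniteSupport_thetaTerm_mul p z (2 * n + 1) n
  have hs := hasFiniteSupport_mul_gaussBinom p (2 * n + 1) n (b := 1) one_ne_zero
    fun j ↦ -(thetaTerm p z j * z⁻¹ * p ^ (n + 1))
  rw [mul_finsum' _ _ h, ← finsum_int_add_sub_comp_add_one
    (h.subset fun i hi ↦ right_ne_zero_of_mul hi) hs]
  refine finsum_congr fun j ↦ ?_
  have h₁ := gaussBinom_succ_zpow (q := p) (2 * n + 1) (n + 1 + 1 * j)
  rw [show (n : ℤ) + 1 + 1 * j - 1 = n + 1 * j by ring] at h₁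
  rw [h₁, thetaTerm_add_one hp hz, show (n : ℤ) + 1 * (j + 1) = n + 1 + 1 * j by ring]
  have e : p ^ j * p ^ (n + 1) = p ^ (n + 1 + 1 * j : ℤ) := by
    rw [← zpow_natCast, zpow_mul_zpow_of_add_eq hp]
    push_cast
    ring
  have ez : z * z⁻¹ = 1 := mul_inv_cancel₀ hz
  linear_combination -thetaTerm p z j * gaussBinom p (2 * n + 1) (n + 1 + 1 * j) *
    (e + p ^ j * p ^ (n + 1) * ez)

/-- A finite form of the Jacobi triple product identity. -/
theorem prod_eq_finsum_thetaTerm {p z : K} (hp : p ≠ 0) (hz : z ≠ 0) (n : ℕ) :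
    ∏ i ∈ range n, ((1 + z * p ^ i) * (1 + z⁻¹ * p ^ (i + 1))) =
      ∑ᶠ j, thetaTerm p z j * gaussBinom p (2 * n) (n + 1 * j) := by
  induction n with
  | zero =>
    rw [finsum_eq_single _ 0]
    · simp [thetaTerm, gaussBinom]
    · intro i hi
      simp [gaussBinom, hi]
  | succ n ih =>
    have h := finsum_thetaTerm_even hp hz n
    rw [finsum_thetaTerm_odd hp hz, ← ih] at h
    rw [prod_range_succ]
    push_cast
    rw [show 2 * (n + 1) = 2 * n + 2 by ring, h]
    ring

theorem finsum_int_even_add_odd {f : ℤ → K} (hf : f.HasFiniteSupport) :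
    ∑ᶠ j, f j = ∑ᶠ i, (f (2 * i) + f (1 + 2 * i)) := by
  have inj₀ : Function.Injective fun i : ℤ ↦ 2 * i := fun i j h ↦ by simpa using h
  have inj₁ : Function.Injective fun i : ℤ ↦ 1 + 2 * i := fun i j h ↦ by simpa using h
  have hdisj : Disjoint (Set.range fun i : ℤ ↦ 2 * i) (Set.range fun i : ℤ ↦ 1 + 2 * i) := by
    rw [Set.disjoint_left]
    rintro _ ⟨i, rfl⟩ ⟨j, hj⟩
    simp only at hj
    lia
  have huniv : (Set.range fun i : ℤ ↦ 2 * i) ∪ (Set.range fun i : ℤ ↦ 1 + 2 * i) = Set.univ := by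
    refine Set.eq_univ_of_forall fun j ↦ ?_
    rcases Int.even_or_odd' j with ⟨k, rfl | rfl⟩
    · exact Or.inl ⟨k, rfl⟩
    · exact Or.inr ⟨k, add_comm _ _⟩
  rw [finsum_add_distrib (Set.Finite.preimage inj₀.injOn hf) (Set.Finite.preimage inj₁.injOn hf),
    ← finsum_mem_range inj₀, ← finsum_mem_range inj₁,
    ← finsum_mem_union' hdisj (hf.inter_of_right _) (hf.inter_of_right _), huniv, finsum_mem_univ]

theorem prod_one_sub_eq_finsum (hq : q ≠ 0) (n : ℕ) :
    ∏ i ∈ range n, ((1 - q ^ (5 * i + 3)) * (1 - q ^ (5 * i + 2))) =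
      ∑ᶠ i : ℤ, (q ^ (10 * i ^ 2 + i) * gaussBinom (q ^ 5) (2 * n) (n + 2 * i) -
        q ^ (10 * i ^ 2 + 11 * i + 3) * gaussBinom (q ^ 5) (2 * n) (n + 1 + 2 * i)) := by
  have hp : q ^ 5 ≠ 0 := pow_ne_zero _ hq
  have hz : -q ^ 3 ≠ 0 := neg_ne_zero.mpr (pow_ne_zero _ hq)
  have h := prod_eq_finsum_thetaTerm hp hz n
  rw [finsum_int_even_add_odd (hasFiniteSupport_thetaTerm_mul _ _ _ _)] at h
  have heven (i : ℤ) : thetaTerm (q ^ 5) (-q ^ 3) (2 * i) = q ^ (10 * i ^ 2 + i) := by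
    rw [thetaTerm, show 2 * i * (2 * i - 1) = (i * (2 * i - 1)) * 2 by ring,
      Int.mul_ediv_cancel _ two_ne_zero, (even_two_mul i).neg_zpow, ← zpow_natCast q,
      ← zpow_natCast q, ← zpow_mul, ← zpow_mul]
    exact zpow_mul_zpow_of_add_eq hq (by push_cast; ring)
  calc _ = _ := prod_congr rfl fun i _ ↦ ?_
    _ = _ := h
    _ = _ := finsum_congr fun i ↦ ?_
  · have e : (-q ^ 3)⁻¹ * (q ^ 5) ^ (i + 1) = -q ^ (5 * i + 2) := by
      rw [inv_mul_eq_iff_eq_mul₀ hz]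
      ring
    rw [e]
    ring
  · rw [add_comm 1 (2 * i), thetaTerm_add_one hp hz, heven, ← zpow_natCast q 5, ← zpow_mul,
      one_mul, one_mul, show (n : ℤ) + (2 * i + 1) = n + 1 + 2 * i by ring]
    have e : q ^ (10 * i ^ 2 + i) * q ^ 3 * q ^ (((5 : ℕ) : ℤ) * (2 * i)) =
        q ^ (10 * i ^ 2 + 11 * i + 3) := by
      rw [← zpow_natCast q 3, ← zpow_add₀ hq, ← zpow_add₀ hq]
      congr 1
      push_cast
      ring
    rw [← e]
    ring

end Field

section Partitions

/-- The subsets of `{1, ..., n}` without consecutive elements. -/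
def spacedSubsets (n : ℕ) : Finset (Finset ℕ) := {s ∈ (Icc 1 n).powerset | ∀ a ∈ s, a + 1 ∉ s}

theorem mem_spacedSubsets {n : ℕ} {s : Finset ℕ} :
    s ∈ spacedSubsets n ↔ (∀ a ∈ s, 1 ≤ a ∧ a ≤ n) ∧ ∀ a ∈ s, a + 1 ∉ s := by
  simp [spacedSubsets, subset_iff]

theorem spacedSubsets_add_two (n : ℕ) :
    spacedSubsets (n + 2) = spacedSubsets (n + 1) ∪ (spacedSubsets n).image (insert (n + 2)) := by
  ext s
  simp only [mem_union, mem_image, mem_spacedSubsets]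
  constructor
  · rintro ⟨hs, hs'⟩
    by_cases h : n + 2 ∈ s
    · refine Or.inr ⟨s.erase (n + 2), ⟨fun a ha ↦ ?_, fun a ha ↦ ?_⟩, insert_erase h⟩
      · rw [mem_erase] at ha
        have := hs a ha.2
        have : a ≠ n + 1 := fun h' ↦ hs' a ha.2 (h' ▸ h)
        lia
      · exact fun h' ↦ hs' a (mem_of_mem_erase ha) (mem_of_mem_erase h')
    · refine Or.inl ⟨fun a ha ↦ ?_, hs'⟩
      have := hs a ha
      have : a ≠ n + 2 := fun h' ↦ h (h' ▸ ha)
      lia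
  · rintro (⟨hs, hs'⟩ | ⟨t, ⟨ht, ht'⟩, rfl⟩)
    · exact ⟨fun a ha ↦ ⟨(hs a ha).1, (hs a ha).2.trans (by lia)⟩, hs'⟩
    · grind

theorem sum_spacedSubsets {R : Type*} [CommRing R] (q : R) (n : ℕ) :
    ∑ s ∈ spacedSubsets n, q ^ (∑ a ∈ s, a) = schurPoly q (n + 1) := by
  induction n using Nat.twoStepInduction with
  | zero =>
    rw [show spacedSubsets 0 = {∅} by decide]
    simp [schurPoly]
  | one =>
    rw [show spacedSubsets 1 = {∅, {1}} by decide]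
    simp [schurPoly]
  | more n ih₀ ih₁ =>
    have hnot {k : ℕ} {s : Finset ℕ} (hs : s ∈ spacedSubsets k) {a : ℕ} (ha : k < a) : a ∉ s :=
      fun h ↦ by have := (mem_spacedSubsets.mp hs).1 a h; lia
    rw [spacedSubsets_add_two, sum_union, sum_image, ih₁, schurPoly.eq_3 q (n + 1), ← ih₀, mul_sum]
    · refine congrArg _ (sum_congr rfl fun s hs ↦ ?_)
      rw [sum_insert (hnot hs (by lia)), pow_add]
    · intro s hs t ht h
      rw [← erase_insert (hnot hs (show n < n + 2 by lia)), h, erase_insert (hnot ht (by lia))]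
    · rw [disjoint_left]
      intro s hs hs'
      obtain ⟨t, -, rfl⟩ := mem_image.mp hs'
      exact hnot hs (by lia) (mem_insert_self _ _)

theorem card_partition_spaced {N n : ℕ} (hn : N ≤ n) :
    Nat.card {p : Nat.Partition N //
      p.parts.Nodup ∧ ∀ a ∈ p.parts, ∀ b ∈ p.parts, a ≠ b → 2 ≤ |(a : ℤ) - b|} =
    #{s ∈ spacedSubsets n | ∑ a ∈ s, a = N} := by
  rw [← Nat.card_eq_finsetCard]
  refine Nat.card_congr
    { toFun p := ⟨⟨p.1.parts, p.2.1⟩, ?_⟩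
      invFun s := ⟨⟨s.1.val, ?_, ?_⟩, s.1.nodup, ?_⟩
      left_inv p := rfl
      right_inv s := rfl }
  · obtain ⟨p, hp, hp'⟩ := p
    simp only [mem_filter, mem_spacedSubsets, mem_mk]
    refine ⟨⟨fun a ha ↦ ⟨p.parts_pos ha, (p.le_of_mem_parts ha).trans hn⟩, fun a ha ha' ↦ ?_⟩, ?_⟩
    · have := hp' a ha _ ha' (by lia)
      grind
    · exact (Finset.sum_val ⟨p.parts, hp⟩).symm.trans p.parts_sum
  · intro i hi
    exact ((mem_spacedSubsets.mp (mem_filter.mp s.2).1).1 i hi).1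
  · exact (Finset.sum_val s.1).trans (mem_filter.mp s.2).2
  · intro a ha b hb hab
    have h := (mem_spacedSubsets.mp (mem_filter.mp s.2).1).2
    rw [Finset.mem_val] at ha hb
    have h₁ : b ≠ a + 1 := fun e ↦ h a ha (e ▸ hb)
    have h₂ : a ≠ b + 1 := fun e ↦ h b hb (e ▸ ha)
    grind

open PowerSeries in
theorem coeff_schurPoly_X {R : Type*} [CommRing R] {N n : ℕ} (hn : N ≤ n) :
    coeff N (schurPoly (X : R⟦X⟧) (n + 1)) =
      (Nat.card {p : Nat.Partition N //
        p.parts.Nodup ∧ ∀ a ∈ p.parts, ∀ b ∈ p.parts, a ≠ b → 2 ≤ |(a : ℤ) - b|} : R) := by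
  rw [card_partition_spaced hn, ← sum_spacedSubsets, map_sum, card_filter, Nat.cast_sum]
  exact sum_congr rfl fun s _ ↦ by simp [coeff_X_pow, eq_comm]

open PowerSeries WithPiTopology Filter in
theorem eventually_X_pow_dvd_restricted_mul_sub_one (R : Type*) [CommRing R] (p : ℕ → Prop)
    [DecidablePred p] (M : ℕ) :
    ∀ᶠ s : Finset ℕ in atTop, (X : R⟦X⟧) ^ M ∣
      PowerSeries.mk (fun n ↦ (#(Nat.Partition.restricted n p) : R)) *
        ∏ i ∈ s, (if p (i + 1) then 1 - X ^ (i + 1) else 1) - 1 := by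
  let _ : TopologicalSpace R := ⊥
  have _ : DiscreteTopology R := ⟨rfl⟩
  have h := Nat.Partition.hasProd_powerSeriesMk_card_restricted R p
  rw [HasProd, tendsto_iff_coeff_tendsto] at h
  have h' : ∀ᶠ s : Finset ℕ in atTop, ∀ d ∈ range M, _ := (Filter.eventually_all_finset _).mpr
    fun d _ ↦ by simpa using h d
  filter_upwards [h'] with s hs
  have hinv : (∏ i ∈ s, (if p (i + 1) then ∑' j : ℕ, (X : R⟦X⟧) ^ ((i + 1) * j) else 1)) *
      ∏ i ∈ s, (if p (i + 1) then 1 - X ^ (i + 1) else 1) = 1 := by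
    rw [← prod_mul_distrib]
    refine prod_eq_one fun i _ ↦ ?_
    split_ifs
    · simp_rw [pow_mul]
      exact tsum_pow_mul_one_sub_of_constantCoeff_eq_zero (by simp)
    · simp
  have hdvd : (X : R⟦X⟧) ^ M ∣ PowerSeries.mk (fun n ↦ (#(Nat.Partition.restricted n p) : R)) -
      ∏ i ∈ s, (if p (i + 1) then ∑' j : ℕ, (X : R⟦X⟧) ^ ((i + 1) * j) else 1) := by
    rw [X_pow_dvd_iff]
    intro d hd
    rw [map_sub, hs d (mem_range.mpr hd), coeff_mk, sub_self]
  have h₁ := hdvd.mul_right (∏ i ∈ s, if p (i + 1) then (1 : R⟦X⟧) - X ^ (i + 1) else 1)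
  rwa [sub_mul, hinv] at h₁

end Partitions

section PowerSeries

open PowerSeries

theorem ofPowerSeries_X_ne_zero : HahnSeries.ofPowerSeries ℤ ℚ X ≠ 0 := by
  rw [Ne, map_eq_zero_iff _ HahnSeries.ofPowerSeries_injective]
  exact X_ne_zero

theorem zero_le_evenExponent (i : ℤ) : 0 ≤ 10 * i ^ 2 + i := by nlinarith [Int.le_self_sq (-i)]

theorem zero_le_oddExponent (i : ℤ) : 0 ≤ 10 * i ^ 2 + 11 * i + 3 := by
  rcases le_or_gt 0 i with hi | hi <;> nlinarith

theorem hasFiniteSupport_sub_mul_gaussBinom {R : Type*} [CommRing R] (p : R) (n : ℕ) (a a' : ℤ)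
    {b : ℤ} (hb : b ≠ 0) (c c' : ℤ → R) :
    Function.HasFiniteSupport fun i : ℤ ↦ c i * gaussBinom p n (a + b * i) -
      c' i * gaussBinom p n (a' + b * i) :=
  (hasFiniteSupport_mul_gaussBinom p n a hb c).fun_sub
    (hasFiniteSupport_mul_gaussBinom p n a' hb c')

theorem eq_finsum_of_ofPowerSeries_eq {F p : ℚ⟦X⟧} {n : ℕ} {a a' b : ℤ} (hb : b ≠ 0)
    (h : HahnSeries.ofPowerSeries ℤ ℚ F = ∑ᶠ i : ℤ,
      (HahnSeries.ofPowerSeries ℤ ℚ X ^ (10 * i ^ 2 + i) *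
          gaussBinom (HahnSeries.ofPowerSeries ℤ ℚ p) n (a + b * i) -
        HahnSeries.ofPowerSeries ℤ ℚ X ^ (10 * i ^ 2 + 11 * i + 3) *
          gaussBinom (HahnSeries.ofPowerSeries ℤ ℚ p) n (a' + b * i))) :
    F = ∑ᶠ i : ℤ, (X ^ (10 * i ^ 2 + i).toNat * gaussBinom p n (a + b * i) -
      X ^ (10 * i ^ 2 + 11 * i + 3).toNat * gaussBinom p n (a' + b * i)) := by
  apply HahnSeries.ofPowerSeries_injective (Γ := ℤ)
  rw [h, map_finsum _ (hasFiniteSupport_sub_mul_gaussBinom p n a a' hb _ _)]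
  refine finsum_congr fun i ↦ ?_
  simp only [map_sub, map_mul, map_pow, map_gaussBinom, ← zpow_natCast,
    Int.toNat_of_nonneg (zero_le_evenExponent i), Int.toNat_of_nonneg (zero_le_oddExponent i)]

theorem schurPoly_X_eq_finsum (m : ℕ) :
    schurPoly (X : ℚ⟦X⟧) (2 * m) =
      ∑ᶠ i : ℤ, (X ^ (10 * i ^ 2 + i).toNat * gaussBinom X (2 * m) (m + -5 * i) -
        X ^ (10 * i ^ 2 + 11 * i + 3).toNat * gaussBinom X (2 * m) (m - 3 + -5 * i)) := by
  apply eq_finsum_of_ofPowerSeries_eq (by norm_num)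
  rw [map_schurPoly, (schurPoly_eq_finsum ofPowerSeries_X_ne_zero m).1]
  rfl

theorem prod_one_sub_X_eq_finsum (n : ℕ) :
    ∏ i ∈ range n, ((1 - (X : ℚ⟦X⟧) ^ (5 * i + 3)) * (1 - X ^ (5 * i + 2))) =
      ∑ᶠ i : ℤ, (X ^ (10 * i ^ 2 + i).toNat * gaussBinom (X ^ 5) (2 * n) (n + 2 * i) -
        X ^ (10 * i ^ 2 + 11 * i + 3).toNat * gaussBinom (X ^ 5) (2 * n) (n + 1 + 2 * i)) := by
  apply eq_finsum_of_ofPowerSeries_eq (by norm_num)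
  simpa using prod_one_sub_eq_finsum ofPowerSeries_X_ne_zero n

/-- The quotient map from power series to power series truncated at `X ^ M`. -/
noncomputable abbrev truncHom (M : ℕ) : ℚ⟦X⟧ →+* ℚ⟦X⟧ ⧸ Ideal.span {(X : ℚ⟦X⟧) ^ M} :=
  Ideal.Quotient.mk _

theorem truncHom_eq_iff {M : ℕ} {f g : ℚ⟦X⟧} : truncHom M f = truncHom M g ↔ X ^ M ∣ f - g := by
  rw [Ideal.Quotient.eq, Ideal.mem_span_singleton]

theorem truncHom_X_pow {M e : ℕ} (h : M ≤ e) : truncHom M (X ^ e) = 0 := by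
  rw [← map_zero (truncHom M), truncHom_eq_iff, sub_zero]
  exact pow_dvd_pow X h

theorem isUnit_of_constantCoeff_eq_one {f : ℚ⟦X⟧} (h : constantCoeff f = 1) : IsUnit f := by
  rw [isUnit_iff_constantCoeff, h]
  exact isUnit_one

theorem isUnit_qFactorial_X_pow {k : ℕ} (hk : k ≠ 0) (n : ℕ) :
    IsUnit (qFactorial ((X : ℚ⟦X⟧) ^ k) n) :=
  isUnit_of_constantCoeff_eq_one <| by simp [qFactorial, map_prod, hk]

theorem truncHom_qFactorial {M k n : ℕ} (hk : k ≠ 0) (hn : M ≤ n) :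
    truncHom M (qFactorial (X ^ k) n) = truncHom M (qFactorial (X ^ k) M) := by
  induction n, hn using Nat.le_induction with
  | base => rfl
  | succ n hn ih =>
    have hle : n + 1 ≤ k * (n + 1) := Nat.le_mul_of_pos_left _ (Nat.pos_of_ne_zero hk)
    rw [qFactorial_succ, map_mul, ih, map_sub, ← pow_mul, truncHom_X_pow (by lia)]
    simp

theorem truncHom_qFactorial_mul_gaussBinom {M k n L : ℕ} {a : ℤ} (hk : k ≠ 0) (hL : M ≤ L)
    (ha : M ≤ a) (ha' : a + M ≤ n) :
    truncHom M (qFactorial (X ^ k) L) * truncHom M (gaussBinom (X ^ k) n a) = 1 := by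
  lift a to ℕ using by lia
  obtain ⟨b, rfl⟩ := Nat.exists_eq_add_of_le (show a ≤ n by lia)
  have h := congrArg (truncHom M) (gaussBinom_mul_qFactorial ((X : ℚ⟦X⟧) ^ k) a b)
  rw [map_mul, map_mul, truncHom_qFactorial hk (show M ≤ a by lia),
    truncHom_qFactorial hk (show M ≤ b by lia),
    truncHom_qFactorial hk (show M ≤ a + b by lia)] at h
  have hu := (isUnit_qFactorial_X_pow hk M).map (truncHom M)
  rw [truncHom_qFactorial hk hL]
  apply hu.mul_left_cancel
  linear_combination h

theorem truncHom_qFactorial_mul_finsum {M k n L : ℕ} {a a' b : ℤ} (hk : k ≠ 0) (hL : M ≤ L)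
    (hb : b ≠ 0)
    (ha : ∀ i : ℤ, 10 * i ^ 2 + i < M → M ≤ a + b * i ∧ a + b * i + M ≤ n)
    (ha' : ∀ i : ℤ, 10 * i ^ 2 + 11 * i + 3 < M → M ≤ a' + b * i ∧ a' + b * i + M ≤ n) :
    truncHom M (qFactorial (X ^ k) L * ∑ᶠ i : ℤ,
      (X ^ (10 * i ^ 2 + i).toNat * gaussBinom (X ^ k) n (a + b * i) -
        X ^ (10 * i ^ 2 + 11 * i + 3).toNat * gaussBinom (X ^ k) n (a' + b * i))) =
      ∑ᶠ i : ℤ, (truncHom M (X ^ (10 * i ^ 2 + i).toNat) -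
        truncHom M (X ^ (10 * i ^ 2 + 11 * i + 3).toNat)) := by
  have hfin := hasFiniteSupport_sub_mul_gaussBinom ((X : ℚ⟦X⟧) ^ k) n a a' hb
    (fun i ↦ X ^ (10 * i ^ 2 + i).toNat) (fun i ↦ X ^ (10 * i ^ 2 + 11 * i + 3).toNat)
  rw [mul_finsum' _ _ hfin, map_finsum _ (hfin.subset fun i hi ↦ right_ne_zero_of_mul hi)]
  refine finsum_congr fun i ↦ ?_
  have aux (e : ℤ) (c : ℤ) (h : e < M → M ≤ c ∧ c + M ≤ n) :
      truncHom M (qFactorial (X ^ k) L) * (truncHom M (X ^ e.toNat) *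
        truncHom M (gaussBinom (X ^ k) n c)) = truncHom M (X ^ e.toNat) := by
    by_cases he : e < M
    · rw [mul_left_comm, truncHom_qFactorial_mul_gaussBinom hk hL (h he).1 (h he).2, mul_one]
    · rw [truncHom_X_pow (show M ≤ e.toNat by lia)]
      simp
  rw [map_mul, map_sub, map_mul, map_mul, mul_sub, aux _ _ (ha i), aux _ _ (ha' i)]

theorem abs_le_evenExponent (i : ℤ) : |i| ≤ 10 * i ^ 2 + i := by
  rcases le_or_gt 0 i with hi | hi
  · rw [abs_of_nonneg hi]; nlinarith
  · rw [abs_of_neg hi]; nlinarith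

theorem abs_le_oddExponent (i : ℤ) : |i| ≤ 10 * i ^ 2 + 11 * i + 3 := by
  rcases le_or_gt 0 i with hi | hi
  · rw [abs_of_nonneg hi]; nlinarith
  · rw [abs_of_neg hi]; nlinarith

theorem truncHom_qFactorial_mul_schurPoly {M n L : ℕ} (hL : M ≤ L) (hn : 6 * M + 3 ≤ n) :
    truncHom M (qFactorial X L * schurPoly X (2 * n)) =
      truncHom M (qFactorial (X ^ 5) n *
        ∏ i ∈ range n, ((1 - X ^ (5 * i + 3)) * (1 - X ^ (5 * i + 2)))) := by
  have h₁ := truncHom_qFactorial_mul_finsum (M := M) (k := 1) (n := 2 * n) (a := n) (a' := n - 3)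
    (b := -5) one_ne_zero hL (by norm_num)
    (fun i hi ↦ by have := (abs_le_evenExponent i).trans_lt hi; grind)
    (fun i hi ↦ by have := (abs_le_oddExponent i).trans_lt hi; grind)
  have h₂ := truncHom_qFactorial_mul_finsum (M := M) (k := 5) (n := 2 * n) (L := n) (a := n)
    (a' := n + 1) (b := 2) (by norm_num) (by lia) (by norm_num)
    (fun i hi ↦ by have := (abs_le_evenExponent i).trans_lt hi; grind)
    (fun i hi ↦ by have := (abs_le_oddExponent i).trans_lt hi; grind)
  rw [pow_one] at h₁
  rw [schurPoly_X_eq_finsum, prod_one_sub_X_eq_finsum, h₁, h₂]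

theorem qFactorial_five_mul {R : Type*} [CommRing R] (q : R) (n : ℕ) :
    qFactorial q (5 * n) =
      qFactorial (q ^ 5) n * (∏ i ∈ range n, ((1 - q ^ (5 * i + 3)) * (1 - q ^ (5 * i + 2)))) *
        ∏ i ∈ range (5 * n),
          (if (i + 1) % 5 = 1 ∨ (i + 1) % 5 = 4 then 1 - q ^ (i + 1) else 1) := by
  induction n with
  | zero => simp [qFactorial]
  | succ n ih =>
    rw [show 5 * (n + 1) = 5 * n + 1 + 1 + 1 + 1 + 1 by ring]
    simp only [qFactorial_succ, prod_range_succ, ih]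
    rw [if_pos (by lia), if_neg (by lia), if_neg (by lia), if_pos (by lia), if_neg (by lia)]
    ring

open Filter in
theorem coeff_schurPoly_X_eq_card_restricted (M : ℕ) :
    ∀ᶠ n in atTop, ∀ d < M, coeff d (schurPoly (X : ℚ⟦X⟧) (2 * n)) =
      #(Nat.Partition.restricted d fun a ↦ a % 5 = 1 ∨ a % 5 = 4) := by
  have hG := (tendsto_finset_range.comp
    (tendsto_id.const_mul_atTop' (r := 5) (by norm_num))).eventually
    (eventually_X_pow_dvd_restricted_mul_sub_one ℚ (fun a ↦ a % 5 = 1 ∨ a % 5 = 4) M)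
  filter_upwards [hG, eventually_ge_atTop (6 * M + 3)] with n hn hM
  have hS := truncHom_qFactorial_mul_schurPoly (M := M) (L := 5 * n) (by lia) hM
  simp only [Function.comp_apply, id_eq] at hn
  rw [← truncHom_eq_iff, map_mul, map_one] at hn
  rw [qFactorial_five_mul, map_mul, map_mul] at hS
  have hu : IsUnit (qFactorial ((X : ℚ⟦X⟧) ^ 5) n *
      ∏ i ∈ range n, ((1 - X ^ (5 * i + 3)) * (1 - X ^ (5 * i + 2)))) :=
    (isUnit_qFactorial_X_pow (by norm_num) n).mul <|
      isUnit_of_constantCoeff_eq_one <| by simp [map_prod]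
  have hR := (hu.map (truncHom M)).mul_left_cancel
    ((mul_assoc _ _ _).symm.trans (hS.trans (mul_one _).symm))
  have h : truncHom M (schurPoly X (2 * n)) = truncHom M
      (PowerSeries.mk fun d ↦ (#(Nat.Partition.restricted d fun a ↦ a % 5 = 1 ∨ a % 5 = 4) : ℚ)) :=
    (left_inv_eq_right_inv hn hR).symm
  rw [truncHom_eq_iff, X_pow_dvd_iff] at h
  intro d hd
  simpa [sub_eq_zero] using h d hd

end PowerSeries

theorem rogers_ramanujan_partitions (N : ℕ) (hN : 0 < N) :
    Nat.card {p : Nat.Partition N // ∀ a ∈ p.parts, a % 5 = 1 ∨ a % 5 = 4} =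
    Nat.card {p : Nat.Partition N //
      p.parts.Nodup ∧ ∀ a ∈ p.parts, ∀ b ∈ p.parts, a ≠ b → 2 ≤ |(a : ℤ) - b|} := by
  obtain ⟨n, h, hn⟩ := ((coeff_schurPoly_X_eq_card_restricted (N + 1)).and
    (Filter.eventually_gt_atTop N)).exists
  have h := h N N.lt_succ_self
  rw [show 2 * n = 2 * n - 1 + 1 by lia, coeff_schurPoly_X (by lia)] at h
  rw [Nat.cast_injective h, Nat.Partition.restricted, Nat.card_eq_fintype_card,
    Fintype.card_subtype]
end

section
/- Jacobi's four-square theorem: for every positive integer n, the number of representations of n as an ordered sum of four squares of integers equals 8 times the sum of the divisors of n that are not divisible by 4. -/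
/-- The integer vectors of length `j` with sum of squares `M`. -/
noncomputable def sqReps (j : ℕ) (M : ℤ) : Finset (Fin j → ℤ) :=
  (Fintype.piFinset fun _ => Finset.Icc (-M) M).filter fun x => ∑ i, x i ^ 2 = M

theorem mem_sqReps {j : ℕ} {M : ℤ} {x : Fin j → ℤ} : x ∈ sqReps j M ↔ ∑ i, x i ^ 2 = M := by
  simp only [sqReps, Finset.mem_filter, Fintype.mem_piFinset, Finset.mem_Icc,
    and_iff_right_iff_imp]
  intro h i
  have h1 : x i ^ 2 ≤ M := by
    rw [← h]
    exact Finset.single_le_sum (f := fun i => x i ^ 2) (fun i _ => sq_nonneg _)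
      (Finset.mem_univ i)
  constructor <;> nlinarith [Int.le_self_sq (x i), Int.le_self_sq (-x i)]

/-- The vectors of length `j` of odd integers with sum of squares `M`. -/
noncomputable def oddReps (j : ℕ) (M : ℤ) : Finset (Fin j → ℤ) :=
  (sqReps j M).filter fun x => ∀ i, Odd (x i)

theorem mem_oddReps {j : ℕ} {M : ℤ} {x : Fin j → ℤ} :
    x ∈ oddReps j M ↔ ∑ i, x i ^ 2 = M ∧ ∀ i, Odd (x i) := by
  simp [oddReps, mem_sqReps]

/-- Positive factorisations `M = 4 * a * d`, as pairs `(a, d)`. -/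
noncomputable def quarterFactors (M : ℤ) : Finset (ℤ × ℤ) :=
  (Finset.Icc 1 M ×ˢ Finset.Icc 1 M).filter fun p => 4 * p.1 * p.2 = M

theorem mem_quarterFactors {M : ℤ} {p : ℤ × ℤ} :
    p ∈ quarterFactors M ↔ 0 < p.1 ∧ 0 < p.2 ∧ 4 * p.1 * p.2 = M := by
  simp only [quarterFactors, Finset.mem_filter, Finset.mem_product, Finset.mem_Icc]
  constructor
  · rintro ⟨⟨⟨h1, -⟩, h2, -⟩, h3⟩
    exact ⟨by lia, by lia, h3⟩
  · rintro ⟨h1, h2, h3⟩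
    refine ⟨⟨⟨by lia, ?_⟩, by lia, ?_⟩, h3⟩ <;> nlinarith

/-- The triples `(k, a, d)` with `a`, `d` positive and `k ^ 2 + 4 * a * d = N`. -/
noncomputable def windmills (N : ℤ) : Finset (ℤ × ℤ × ℤ) :=
  (Finset.Icc (-N) N ×ˢ Finset.Icc 1 N ×ˢ Finset.Icc 1 N).filter
    fun t => t.1 ^ 2 + 4 * t.2.1 * t.2.2 = N

theorem mem_windmills {N k a d : ℤ} :
    (k, a, d) ∈ windmills N ↔ 0 < a ∧ 0 < d ∧ k ^ 2 + 4 * a * d = N := by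
  simp only [windmills, Finset.mem_filter, Finset.mem_product, Finset.mem_Icc]
  constructor
  · rintro ⟨⟨-, ⟨h1, -⟩, h2, -⟩, h3⟩
    exact ⟨by lia, by lia, h3⟩
  · rintro ⟨h1, h2, h3⟩
    have : 0 < a * d := mul_pos h1 h2
    refine ⟨⟨⟨?_, ?_⟩, ⟨by lia, ?_⟩, by lia, ?_⟩, h3⟩ <;>
      nlinarith [Int.le_self_sq k, Int.le_self_sq (-k), sq_nonneg k]

/-- The windmills with `k < a - d`. -/
noncomputable def lowWindmills (N : ℤ) : Finset (ℤ × ℤ × ℤ) :=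
  (windmills N).filter fun t => t.1 < t.2.1 - t.2.2

theorem mem_lowWindmills {N k a d : ℤ} :
    (k, a, d) ∈ lowWindmills N ↔ (0 < a ∧ 0 < d ∧ k ^ 2 + 4 * a * d = N) ∧ k < a - d := by
  simp [lowWindmills, mem_windmills]

/-- A function invariant under `(k, a, d) ↦ (-k, d, a)` sums to twice its sum over the
windmills with `k < a - d`. -/
theorem sum_windmills_eq_two_mul {N : ℤ} (hN : ¬ IsSquare N) (f : ℤ → ℤ → ℤ → ℤ)
    (hf : ∀ k a d, f (-k) d a = f k a d) :
    ∑ t ∈ windmills N, f t.1 t.2.1 t.2.2 = 2 * ∑ t ∈ lowWindmills N, f t.1 t.2.1 t.2.2 := by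
  rw [← Finset.sum_filter_add_sum_filter_not (windmills N) (fun t => t.1 < t.2.1 - t.2.2),
    two_mul]
  congr 1
  refine Finset.sum_nbij' (fun t => (-t.1, t.2.2, t.2.1)) (fun t => (-t.1, t.2.2, t.2.1))
    ?_ ?_ ?_ ?_ ?_
  · rintro ⟨k, a, d⟩ h
    simp only [Finset.mem_filter, mem_windmills] at h
    rw [mem_lowWindmills]
    obtain ⟨⟨h1, h2, h3⟩, h4⟩ := h
    refine ⟨⟨h2, h1, by rw [← h3]; ring⟩, ?_⟩
    have : k ≠ a - d := by
      rintro rfl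
      exact hN ⟨a + d, by rw [← h3]; ring⟩
    lia
  · rintro ⟨k, a, d⟩ h
    rw [mem_lowWindmills] at h
    obtain ⟨⟨h1, h2, h3⟩, h4⟩ := h
    simp only [Finset.mem_filter, mem_windmills]
    exact ⟨⟨h2, h1, by rw [← h3]; ring⟩, by lia⟩
  · simp
  · simp
  · intro t _
    exact (hf _ _ _).symm

theorem sum_windmills_neg {N : ℤ} (f : ℤ → ℤ → ℤ → ℤ) :
    ∑ t ∈ windmills N, f (-t.1) t.2.1 t.2.2 = ∑ t ∈ windmills N, f t.1 t.2.1 t.2.2 := by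
  refine Finset.sum_nbij' (fun t => (-t.1, t.2)) (fun t => (-t.1, t.2)) ?_ ?_ ?_ ?_ ?_
  · rintro ⟨k, a, d⟩ h
    simpa [mem_windmills] using h
  · rintro ⟨k, a, d⟩ h
    simpa [mem_windmills] using h
  all_goals simp

theorem sum_windmills_swap {N : ℤ} (f : ℤ → ℤ → ℤ → ℤ) :
    ∑ t ∈ windmills N, f t.1 t.2.2 t.2.1 = ∑ t ∈ windmills N, f t.1 t.2.1 t.2.2 := by
  refine Finset.sum_nbij' (fun t => (t.1, t.2.2, t.2.1)) (fun t => (t.1, t.2.2, t.2.1))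
    ?_ ?_ ?_ ?_ ?_
  · rintro ⟨k, a, d⟩ h
    rw [mem_windmills] at h ⊢
    exact ⟨h.2.1, h.1, by rw [← h.2.2]; ring⟩
  · rintro ⟨k, a, d⟩ h
    rw [mem_windmills] at h ⊢
    exact ⟨h.2.1, h.1, by rw [← h.2.2]; ring⟩
  all_goals simp

/-- The involution exchanging `a` and `a - k - d` on the windmills with `k < a - d`. -/
theorem sum_lowWindmills_involution {N : ℤ} (f : ℤ → ℤ → ℤ → ℤ) :
    ∑ t ∈ lowWindmills N, f (-t.1 - 2 * t.2.2) (t.2.1 - t.1 - t.2.2) t.2.2 =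
      ∑ t ∈ lowWindmills N, f t.1 t.2.1 t.2.2 := by
  refine Finset.sum_nbij' (fun t => (-t.1 - 2 * t.2.2, t.2.1 - t.1 - t.2.2, t.2.2))
    (fun t => (-t.1 - 2 * t.2.2, t.2.1 - t.1 - t.2.2, t.2.2)) ?_ ?_ ?_ ?_ ?_
  · rintro ⟨k, a, d⟩ h
    rw [mem_lowWindmills] at h ⊢
    exact ⟨⟨by lia, h.1.2.1, by rw [← h.1.2.2]; ring⟩, by lia⟩
  · rintro ⟨k, a, d⟩ h
    rw [mem_lowWindmills] at h ⊢
    exact ⟨⟨by lia, h.1.2.1, by rw [← h.1.2.2]; ring⟩, by lia⟩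
  · rintro ⟨k, a, d⟩ _
    ext <;> dsimp only <;> ring
  · rintro ⟨k, a, d⟩ _
    ext <;> dsimp only <;> ring
  · simp

theorem sum_windmills_eq_zero {N : ℤ} (hN : ¬ IsSquare N) :
    ∑ t ∈ windmills N, (N - 5 * t.1 ^ 2) * t.2.2 = 0 := by
  have hodd : ∑ t ∈ lowWindmills N, t.1 * (t.2.1 ^ 2 - t.2.2 ^ 2) = 0 := by
    have h1 := sum_windmills_eq_two_mul hN (fun k a d => k * (a ^ 2 - d ^ 2))
      (fun k a d => by ring)
    have h2 := sum_windmills_neg (N := N) (fun k a d => k * (a ^ 2 - d ^ 2))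
    simp only [neg_mul, Finset.sum_neg_distrib] at h2
    lia
  have hanti : ∑ t ∈ lowWindmills N,
      (t.2.1 + t.2.2) * (t.2.1 - t.1) * (t.1 + t.2.2) = 0 := by
    have h := sum_lowWindmills_involution (N := N) (fun k a d => (a + d) * (a - k) * (k + d))
    have h' : ∑ t ∈ lowWindmills N, (t.2.1 - t.1 - t.2.2 + t.2.2) *
        (t.2.1 - t.1 - t.2.2 - (-t.1 - 2 * t.2.2)) * (-t.1 - 2 * t.2.2 + t.2.2) =
        -∑ t ∈ lowWindmills N, (t.2.1 + t.2.2) * (t.2.1 - t.1) * (t.1 + t.2.2) := by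
      rw [← Finset.sum_neg_distrib]
      exact Finset.sum_congr rfl fun t _ => by ring
    lia
  have hlow : ∑ t ∈ lowWindmills N, (t.2.1 * t.2.2 - t.1 ^ 2) * (t.2.1 + t.2.2) = 0 := by
    have : ∑ t ∈ lowWindmills N, (t.2.1 * t.2.2 - t.1 ^ 2) * (t.2.1 + t.2.2) =
        ∑ t ∈ lowWindmills N, (t.2.1 + t.2.2) * (t.2.1 - t.1) * (t.1 + t.2.2) -
        ∑ t ∈ lowWindmills N, t.1 * (t.2.1 ^ 2 - t.2.2 ^ 2) := by
      rw [← Finset.sum_sub_distrib]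
      exact Finset.sum_congr rfl fun t _ => by ring
    rw [this, hodd, hanti, sub_zero]
  have hsum := sum_windmills_eq_two_mul hN (fun k a d => (a * d - k ^ 2) * (a + d))
    (fun k a d => by ring)
  have hswap := sum_windmills_swap (N := N) (fun k a d => (a * d - k ^ 2) * d)
  have hsplit : ∑ t ∈ windmills N, (t.2.1 * t.2.2 - t.1 ^ 2) * (t.2.1 + t.2.2) =
      ∑ t ∈ windmills N, (t.2.2 * t.2.1 - t.1 ^ 2) * t.2.1 +
      ∑ t ∈ windmills N, (t.2.1 * t.2.2 - t.1 ^ 2) * t.2.2 := by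
    rw [← Finset.sum_add_distrib]
    exact Finset.sum_congr rfl fun t _ => by ring
  have hfour : ∑ t ∈ windmills N, (N - 5 * t.1 ^ 2) * t.2.2 =
      4 * ∑ t ∈ windmills N, (t.2.1 * t.2.2 - t.1 ^ 2) * t.2.2 := by
    rw [Finset.mul_sum]
    refine Finset.sum_congr rfl ?_
    rintro ⟨k, a, d⟩ h
    rw [mem_windmills] at h
    rw [← h.2.2]
    ring
  lia

/-- The odd integers in `[-N, N]`. -/
noncomputable def oddIcc (N : ℤ) : Finset ℤ := (Finset.Icc (-N) N).filter Odd

theorem sum_windmills_eq_sum_oddIcc {N : ℤ} (hN : Odd N) (f : ℤ → ℤ) :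
    ∑ t ∈ windmills N, f t.1 * t.2.2 =
      ∑ k ∈ oddIcc N, f k * ∑ p ∈ quarterFactors (N - k ^ 2), p.2 := by
  rw [← Finset.sum_fiberwise_of_maps_to (s := windmills N) (t := oddIcc N) (g := fun t => t.1)]
  · refine Finset.sum_congr rfl fun k _ => ?_
    rw [Finset.mul_sum]
    refine Finset.sum_nbij' (fun t => t.2) (fun p => (k, p)) ?_ ?_ ?_ ?_ ?_
    · rintro ⟨k', a, d⟩ h
      simp only [Finset.mem_filter, mem_windmills] at h
      obtain ⟨⟨h1, h2, h3⟩, rfl⟩ := h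
      rw [mem_quarterFactors]
      exact ⟨h1, h2, by lia⟩
    · rintro ⟨a, d⟩ h
      rw [mem_quarterFactors] at h
      simp only [Finset.mem_filter, mem_windmills, and_true]
      exact ⟨h.1, h.2.1, by lia⟩
    · rintro ⟨k', a, d⟩ h
      simp only [Finset.mem_filter] at h
      rw [← h.2]
    · simp
    · rintro ⟨k', a, d⟩ h
      simp only [Finset.mem_filter] at h
      rw [← h.2]
  · rintro ⟨k, a, d⟩ h
    have hk : Odd k := by
      rw [mem_windmills] at h
      have : Odd (k ^ 2 + 4 * a * d) := h.2.2 ▸ hN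
      rw [Int.odd_add, Int.odd_pow' two_ne_zero] at this
      exact this.2 ⟨2 * a * d, by ring⟩
    simp only [windmills, Finset.mem_filter, Finset.mem_product] at h
    simp only [oddIcc, Finset.mem_filter]
    exact ⟨h.1.1, hk⟩

theorem sum_oddReps_succ (j : ℕ) (N : ℤ) (f : ℤ → ℤ) :
    ∑ x ∈ oddReps (j + 1) N, f (x 0) =
      ∑ k ∈ oddIcc N, f k * (oddReps j (N - k ^ 2)).card := by
  rw [← Finset.sum_fiberwise_of_maps_to (s := oddReps (j + 1) N) (t := oddIcc N)
    (g := fun x => x 0)]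
  · refine Finset.sum_congr rfl fun k hk => ?_
    rw [oddIcc, Finset.mem_filter] at hk
    rw [Finset.sum_congr rfl (g := fun _ => f k)
      (fun x hx => by rw [(Finset.mem_filter.1 hx).2]), Finset.sum_const, nsmul_eq_mul, mul_comm]
    congr 2
    refine Finset.card_nbij' (fun x => Fin.tail x) (fun x => Fin.cons k x) ?_ ?_ ?_ ?_
    · intro x hx
      simp only [Finset.coe_filter, Set.mem_ofPred_eq, mem_oddReps, Fin.sum_univ_succ] at hx
      obtain ⟨⟨h1, h2⟩, rfl⟩ := hx
      simp only [Finset.mem_coe, mem_oddReps, Fin.tail]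
      exact ⟨by lia, fun i => h2 _⟩
    · intro x hx
      simp only [Finset.mem_coe, mem_oddReps] at hx
      simp only [Finset.coe_filter, Set.mem_ofPred_eq, mem_oddReps, Fin.sum_univ_succ,
        Fin.cons_zero, Fin.cons_succ, Fin.forall_fin_succ, and_true]
      exact ⟨by lia, hk.2, hx.2⟩
    · intro x hx
      simp only [Finset.coe_filter, Set.mem_ofPred_eq] at hx
      simp [← hx.2]
    · intro x _
      simp
  · intro x hx
    rw [oddReps, Finset.mem_filter] at hx
    simp only [sqReps, Finset.mem_filter, Fintype.mem_piFinset] at hx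
    exact Finset.mem_filter.2 ⟨hx.1.1 0, hx.2 0⟩

theorem comp_perm_mem_sqReps {j : ℕ} {M : ℤ} {x : Fin j → ℤ} (e : Equiv.Perm (Fin j))
    (hx : x ∈ sqReps j M) : x ∘ e ∈ sqReps j M := by
  rw [mem_sqReps] at hx ⊢
  rw [← hx]
  exact Equiv.sum_comp e fun i => x i ^ 2

theorem sum_oddReps_apply_sq {j : ℕ} (N : ℤ) (i i' : Fin j) :
    ∑ x ∈ oddReps j N, x i ^ 2 = ∑ x ∈ oddReps j N, x i' ^ 2 := by
  have key : ∀ x ∈ oddReps j N, x ∘ Equiv.swap i i' ∈ oddReps j N := by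
    intro x hx
    rw [oddReps, Finset.mem_filter] at hx ⊢
    exact ⟨comp_perm_mem_sqReps _ hx.1, fun l => hx.2 _⟩
  refine Finset.sum_nbij' (fun x => x ∘ Equiv.swap i i') (fun x => x ∘ Equiv.swap i i')
    key key ?_ ?_ ?_
  · intro x _
    ext l
    simp
  · intro x _
    ext l
    simp
  · intro x _
    simp

theorem sum_oddReps_eq_zero (j : ℕ) (N : ℤ) :
    ∑ x ∈ oddReps (j + 1) N, (N - (j + 1) * x 0 ^ 2) = 0 := by
  have h : ∑ x ∈ oddReps (j + 1) N, N = ∑ x ∈ oddReps (j + 1) N, (j + 1) * x 0 ^ 2 := by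
    calc ∑ x ∈ oddReps (j + 1) N, N = ∑ x ∈ oddReps (j + 1) N, ∑ i, x i ^ 2 :=
          Finset.sum_congr rfl fun x hx => (mem_oddReps.1 hx).1.symm
      _ = ∑ i : Fin (j + 1), ∑ x ∈ oddReps (j + 1) N, x 0 ^ 2 := by
          rw [Finset.sum_comm]
          exact Finset.sum_congr rfl fun i _ => sum_oddReps_apply_sq N i 0
      _ = _ := by simp [Finset.mul_sum]
  rw [Finset.sum_sub_distrib, h, sub_self]

theorem card_oddReps_four_four : (oddReps 4 4).card = 16 := by
  have : oddReps 4 4 = Fintype.piFinset fun _ => {1, -1} := by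
    ext x
    simp only [mem_oddReps, Fintype.mem_piFinset, Finset.mem_insert, Finset.mem_singleton]
    constructor
    · rintro ⟨h1, h2⟩ i
      have hpos : ∀ i, 1 ≤ x i ^ 2 := fun i => by
        have : x i ≠ 0 := fun h => by simpa [h] using h2 i
        have := sq_pos_of_ne_zero this
        lia
      rw [Fin.sum_univ_four] at h1
      have := hpos 0
      have := hpos 1
      have := hpos 2
      have := hpos 3
      rw [← sq_eq_one_iff]
      suffices x i ^ 2 ≤ 1 from le_antisymm this (hpos i)
      fin_cases i <;> dsimp <;> lia
    · intro h
      refine ⟨?_, fun i => ?_⟩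
      · rw [Finset.sum_congr rfl fun i _ => sq_eq_one_iff.2 (h i)]
        simp
      · rcases h i with h | h <;> rw [h] <;> decide
  rw [this, Fintype.card_piFinset]
  simp

theorem card_oddReps_four (n : ℕ) :
    ((oddReps 4 (8 * n + 4)).card : ℤ) = 16 * ∑ p ∈ quarterFactors (8 * n + 4), p.2 := by
  induction n using Nat.strong_induction_on with
  | _ n ih =>
    rcases Nat.eq_zero_or_pos n with rfl | hn
    · have h : ∑ p ∈ quarterFactors 4, p.2 = 1 := by decide
      simp [h, card_oddReps_four_four]
    set N : ℤ := 8 * n + 5 with hN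
    have hNodd : Odd N := ⟨4 * n + 2, by lia⟩
    have hmod : ∀ k : ℤ, Odd k → k ^ 2 % 8 = 1 := by
      rintro _ ⟨j, rfl⟩
      obtain ⟨l, hl⟩ := Int.even_mul_succ_self j
      have : (2 * j + 1) ^ 2 = 8 * l + 1 := by linear_combination 4 * hl
      lia
    have hNsq : ¬ IsSquare N := by
      rintro ⟨r, hr⟩
      have : Odd r := by
        rw [hr, Int.odd_mul] at hNodd
        exact hNodd.1
      have := hmod r this
      rw [sq, ← hr] at this
      lia
    have h1 := sum_oddReps_succ 4 N fun k => N - 5 * k ^ 2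
    have h2 : ∑ x ∈ oddReps (4 + 1) N, (N - 5 * x 0 ^ 2) = 0 := by
      simpa only [Nat.cast_ofNat, show (4 + 1 : ℤ) = 5 from rfl] using sum_oddReps_eq_zero 4 N
    rw [h2] at h1
    have h3 := sum_windmills_eq_sum_oddIcc hNodd fun k => N - 5 * k ^ 2
    rw [sum_windmills_eq_zero hNsq] at h3
    set c : ℤ → ℤ := fun M => (oddReps 4 M).card - 16 * ∑ p ∈ quarterFactors M, p.2 with hc
    have h4 : ∑ k ∈ oddIcc N, (N - 5 * k ^ 2) * c (N - k ^ 2) = 0 := by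
      simp only [hc, mul_sub, Finset.sum_sub_distrib]
      rw [← h1, zero_sub, neg_eq_zero]
      simp only [mul_left_comm _ (16 : ℤ)]
      rw [← Finset.mul_sum, ← h3, mul_zero]
    have hsub : ({1, -1} : Finset ℤ) ⊆ oddIcc N := by
      intro k hk
      simp only [Finset.mem_insert, Finset.mem_singleton] at hk
      simp only [oddIcc, Finset.mem_filter, Finset.mem_Icc]
      rcases hk with rfl | rfl
      · exact ⟨by lia, by decide⟩
      · exact ⟨by lia, by decide⟩
    rw [← Finset.sum_subset hsub] at h4
    · rw [Finset.sum_pair (by decide)] at h4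
      have hM : N - 1 = 8 * n + 4 := by lia
      norm_num at h4
      rw [hM] at h4
      have h5 : N - 5 ≠ 0 := by lia
      have h6 : c (8 * n + 4) = 0 := by
        rcases h4 with h4 | h4
        · exact absurd h4 h5
        · exact h4
      simp only [hc] at h6
      lia
    · intro k hk hk1
      simp only [oddIcc, Finset.mem_filter] at hk
      simp only [Finset.mem_insert, Finset.mem_singleton, ← sq_eq_one_iff] at hk1
      have hk8 := hmod k hk.2
      suffices c (N - k ^ 2) = 0 by rw [this, mul_zero]
      rcases lt_or_ge (N - k ^ 2) 0 with hneg | hpos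
      · have e1 : oddReps 4 (N - k ^ 2) = ∅ := by
          rw [Finset.eq_empty_iff_forall_notMem]
          intro x hx
          have : 0 ≤ ∑ i, x i ^ 2 := Finset.sum_nonneg fun i _ => sq_nonneg _
          rw [(mem_oddReps.1 hx).1] at this
          lia
        have e2 : quarterFactors (N - k ^ 2) = ∅ := by
          rw [quarterFactors, Finset.Icc_eq_empty (by lia)]
          simp
        simp [hc, e1, e2]
      · have hk0 := sq_nonneg k
        obtain ⟨n', hn'⟩ : ∃ n' : ℕ, N - k ^ 2 = 8 * n' + 4 :=
          ⟨((N - k ^ 2) / 8).toNat, by lia⟩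
        have := ih n' (by lia)
        rw [← hn'] at this
        simp only [hc]
        lia

theorem sum_quarterFactors (m : ℕ) :
    ∑ p ∈ quarterFactors (4 * m), p.2 = ((∑ d ∈ m.divisors, d : ℕ) : ℤ) := by
  push_cast
  refine Finset.sum_nbij' (fun p => p.2.toNat) (fun d => ((m / d : ℕ), (d : ℤ))) ?_ ?_ ?_ ?_ ?_
  · rintro ⟨a, d⟩ h
    rw [mem_quarterFactors] at h
    obtain ⟨h1, h2, h3⟩ := h
    dsimp only at *
    lift a to ℕ using h1.le
    lift d to ℕ using h2.le
    have : a * d = m := by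
      zify
      lia
    subst this
    simp
    lia
  · intro d hd
    rw [Nat.mem_divisors] at hd
    obtain ⟨⟨e, rfl⟩, h0⟩ := hd
    have hd0 : 0 < d := Nat.pos_of_ne_zero (by rintro rfl; simp at h0)
    have he0 : 0 < e := Nat.pos_of_ne_zero (by rintro rfl; simp at h0)
    rw [mem_quarterFactors, Nat.mul_div_cancel_left _ hd0]
    refine ⟨by simpa using he0, by simpa using hd0, ?_⟩
    push_cast
    ring
  · rintro ⟨a, d⟩ h
    rw [mem_quarterFactors] at h
    obtain ⟨h1, h2, h3⟩ := h
    dsimp only at *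
    lift a to ℕ using h1.le
    lift d to ℕ using h2.le
    have : a * d = m := by
      zify
      lia
    subst this
    rw [Int.toNat_natCast, Nat.mul_div_cancel _ (by lia)]
  · simp
  · rintro ⟨a, d⟩ h
    rw [mem_quarterFactors] at h
    dsimp only at *
    lia

theorem Int.mod_two_and_sq_mod_four (z : ℤ) :
    z % 2 = 0 ∧ z ^ 2 % 4 = 0 ∨ z % 2 = 1 ∧ z ^ 2 % 4 = 1 := by
  rcases Int.even_or_odd' z with ⟨c, rfl | rfl⟩
  · left
    ring_nf
    lia
  · right
    ring_nf
    lia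

/-- Vectors `x` with `x 0 ≡ x 1` and `x 2 ≡ x 3` modulo 2 and sum of squares `2 * M` correspond to
vectors with sum of squares `M`. -/
theorem card_sqReps_filter_even (M : ℤ) :
    ((sqReps 4 (2 * M)).filter fun x => Even (x 0 + x 1) ∧ Even (x 2 + x 3)).card =
      (sqReps 4 M).card := by
  refine Finset.card_nbij'
    (fun x => ![(x 0 + x 1) / 2, (x 0 - x 1) / 2, (x 2 + x 3) / 2, (x 2 - x 3) / 2])
    (fun x => ![x 0 + x 1, x 0 - x 1, x 2 + x 3, x 2 - x 3]) ?_ ?_ ?_ ?_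
  · intro x hx
    simp only [Finset.coe_filter, Set.mem_ofPred_eq, mem_sqReps, Fin.sum_univ_four] at hx
    obtain ⟨h1, ⟨u, hu⟩, v, hv⟩ := hx
    have e1 : (x 0 + x 1) / 2 = u := by lia
    have e2 : (x 0 - x 1) / 2 = u - x 1 := by lia
    have e3 : (x 2 + x 3) / 2 = v := by lia
    have e4 : (x 2 - x 3) / 2 = v - x 3 := by lia
    have h0 : x 0 = 2 * u - x 1 := by lia
    have h2 : x 2 = 2 * v - x 3 := by lia
    rw [h0, h2] at h1
    simp only [Finset.mem_coe, mem_sqReps, Fin.sum_univ_four, e1, e2, e3, e4]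
    simp
    linarith
  · intro x hx
    simp only [Finset.mem_coe, mem_sqReps, Fin.sum_univ_four] at hx
    simp only [Finset.coe_filter, Set.mem_ofPred_eq, mem_sqReps, Fin.sum_univ_four]
    refine ⟨?_, ⟨x 0, ?_⟩, x 2, ?_⟩
    · simp
      linarith
    · simp
    · simp
  · intro x hx
    simp only [Finset.coe_filter, Set.mem_ofPred_eq] at hx
    obtain ⟨-, ⟨u, hu⟩, v, hv⟩ := hx
    ext i
    fin_cases i <;> simp <;> lia
  · intro x _
    ext i
    fin_cases i <;> simp <;> lia

theorem card_sqReps_filter_comp_perm {j : ℕ} (M : ℤ) (e : Equiv.Perm (Fin j))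
    (p : (Fin j → ℤ) → Prop) [DecidablePred p] :
    ((sqReps j M).filter fun x => p (x ∘ e)).card = ((sqReps j M).filter p).card := by
  refine Finset.card_nbij' (fun x => x ∘ e) (fun x => x ∘ e.symm) ?_ ?_ ?_ ?_
  · intro x hx
    simp only [Finset.coe_filter, Set.mem_ofPred_eq] at hx ⊢
    exact ⟨comp_perm_mem_sqReps e hx.1, hx.2⟩
  · intro x hx
    simp only [Finset.coe_filter, Set.mem_ofPred_eq] at hx ⊢
    refine ⟨comp_perm_mem_sqReps e.symm hx.1, ?_⟩
    simpa [Function.comp_assoc] using hx.2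
  · intro x _
    simp [Function.comp_assoc]
  · intro x _
    simp [Function.comp_assoc]

theorem card_sqReps_two_mul_of_even {M : ℤ} (hM : Even M) :
    (sqReps 4 (2 * M)).card = (sqReps 4 M).card := by
  rw [← card_sqReps_filter_even M, Finset.filter_true_of_mem]
  intro x hx
  rw [mem_sqReps, Fin.sum_univ_four] at hx
  rw [Int.even_iff] at hM ⊢
  rw [Int.even_iff]
  have := Int.mod_two_and_sq_mod_four (x 0)
  have := Int.mod_two_and_sq_mod_four (x 1)
  have := Int.mod_two_and_sq_mod_four (x 2)
  have := Int.mod_two_and_sq_mod_four (x 3)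
  generalize x 0 ^ 2 = y0 at *
  generalize x 1 ^ 2 = y1 at *
  generalize x 2 ^ 2 = y2 at *
  generalize x 3 ^ 2 = y3 at *
  omega

theorem card_sqReps_two_mul_of_odd {M : ℤ} (hM : Odd M) :
    (sqReps 4 (2 * M)).card = 3 * (sqReps 4 M).card := by
  have h1 := card_sqReps_filter_comp_perm (2 * M) (Equiv.swap (1 : Fin 4) 2)
    fun x => Even (x 0 + x 1) ∧ Even (x 2 + x 3)
  have h2 := card_sqReps_filter_comp_perm (2 * M) (Equiv.swap (1 : Fin 4) 3)
    fun x => Even (x 0 + x 1) ∧ Even (x 2 + x 3)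
  have h0 := card_sqReps_filter_even M
  rw [h0] at h1 h2
  rw [Finset.card_filter] at h0 h1 h2
  have h3 : 3 * (sqReps 4 M).card =
      (sqReps 4 M).card + (sqReps 4 M).card + (sqReps 4 M).card := by ring
  rw [h3]
  nth_rewrite 1 [← h0]
  nth_rewrite 1 [← h1]
  nth_rewrite 1 [← h2]
  rw [← Finset.sum_add_distrib, ← Finset.sum_add_distrib, Finset.card_eq_sum_ones]
  refine Finset.sum_congr rfl fun x hx => ?_
  rw [mem_sqReps, Fin.sum_univ_four] at hx
  rw [Int.odd_iff] at hM
  have e1 : Equiv.swap (1 : Fin 4) 2 0 = 0 := by decide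
  have e2 : Equiv.swap (1 : Fin 4) 2 3 = 3 := by decide
  have e3 : Equiv.swap (1 : Fin 4) 3 0 = 0 := by decide
  have e4 : Equiv.swap (1 : Fin 4) 3 2 = 2 := by decide
  simp only [Function.comp_apply, Equiv.swap_apply_left, Equiv.swap_apply_right, e1, e2, e3, e4,
    Int.even_iff]
  have := Int.mod_two_and_sq_mod_four (x 0)
  have := Int.mod_two_and_sq_mod_four (x 1)
  have := Int.mod_two_and_sq_mod_four (x 2)
  have := Int.mod_two_and_sq_mod_four (x 3)
  generalize x 0 ^ 2 = y0 at *
  generalize x 1 ^ 2 = y1 at *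
  generalize x 2 ^ 2 = y2 at *
  generalize x 3 ^ 2 = y3 at *
  split_ifs <;> omega

theorem card_sqReps_four_mul (M : ℤ) :
    (sqReps 4 (4 * M)).card = (oddReps 4 (4 * M)).card + (sqReps 4 M).card := by
  rw [← Finset.card_filter_add_card_filter_not (s := sqReps 4 (4 * M)) fun x => ∀ i, Odd (x i)]
  congr 1
  symm
  refine Finset.card_nbij (fun x i => 2 * x i) ?_ ?_ ?_
  · intro x hx
    simp only [Finset.mem_coe, mem_sqReps] at hx
    simp only [Finset.coe_filter, Set.mem_ofPred_eq, mem_sqReps, mul_pow, ← Finset.mul_sum, hx]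
    exact ⟨by norm_num, fun h => Int.not_odd_iff_even.2 (even_two_mul (x 0)) (h 0)⟩
  · intro x _ y _ h
    ext i
    simpa using congrFun h i
  · intro x hx
    simp only [Finset.coe_filter, Set.mem_ofPred_eq, mem_sqReps, Int.odd_iff] at hx
    have heven : ∀ i, x i % 2 = 0 := by
      simp only [Fin.sum_univ_four, Fin.forall_fin_succ, IsEmpty.forall_iff, and_true] at hx ⊢
      simp only [Fin.succ_zero_eq_one, Fin.succ_one_eq_two, Fin.reduceSucc] at hx ⊢
      have := Int.mod_two_and_sq_mod_four (x 0)
      have := Int.mod_two_and_sq_mod_four (x 1)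
      have := Int.mod_two_and_sq_mod_four (x 2)
      have := Int.mod_two_and_sq_mod_four (x 3)
      generalize x 0 ^ 2 = y0 at *
      generalize x 1 ^ 2 = y1 at *
      generalize x 2 ^ 2 = y2 at *
      generalize x 3 ^ 2 = y3 at *
      omega
    have hx2 : ∀ i, 2 * (x i / 2) = x i := fun i => by have := heven i; lia
    refine ⟨fun i => x i / 2, ?_, funext hx2⟩
    have h4 : 4 * ∑ i, (x i / 2) ^ 2 = 4 * M := by
      rw [← hx.1, Finset.mul_sum]
      refine Finset.sum_congr rfl fun i _ => ?_
      nth_rewrite 2 [← hx2 i]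
      ring
    simp only [Finset.mem_coe, mem_sqReps]
    lia

theorem card_sqReps_of_odd {m : ℕ} (hm : Odd m) :
    (sqReps 4 m).card = 8 * ∑ d ∈ m.divisors, d := by
  have h1 := card_sqReps_four_mul m
  have h2 := card_sqReps_two_mul_of_odd (M := m) (by exact_mod_cast hm)
  have h3 := card_sqReps_two_mul_of_even (M := 2 * m) (even_two_mul _)
  have h4 : ((oddReps 4 (4 * m)).card : ℤ) = 16 * ((∑ d ∈ m.divisors, d : ℕ) : ℤ) := by
    rw [← sum_quarterFactors]
    obtain ⟨j, rfl⟩ := hm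
    have := card_oddReps_four j
    have e : (4 * ((2 * j + 1 : ℕ) : ℤ)) = 8 * j + 4 := by push_cast; ring
    rw [e, this]
  rw [← mul_assoc, show (2 * 2 : ℤ) = 4 from rfl] at h3
  lia

theorem card_sqReps_two_pow_mul (k : ℕ) {m : ℕ} (hm : Odd m) :
    (sqReps 4 (2 ^ (k + 1) * m)).card = 24 * ∑ d ∈ m.divisors, d := by
  induction k with
  | zero =>
    rw [zero_add, pow_one, card_sqReps_two_mul_of_odd (by exact_mod_cast hm),
      card_sqReps_of_odd hm]
    ring
  | succ k ih =>
    rw [← ih, ← card_sqReps_two_mul_of_even (M := 2 ^ (k + 1) * m)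
      ⟨2 ^ k * m, by ring⟩, pow_succ' _ (k + 1), mul_assoc]

theorem filter_not_four_dvd_divisors_of_odd {m : ℕ} (hm : Odd m) :
    m.divisors.filter (fun d => ¬ 4 ∣ d) = m.divisors := by
  refine Finset.filter_true_of_mem fun d hd h => ?_
  have h2 : 2 ∣ m := (Dvd.intro 2 rfl : 2 ∣ 4).trans (h.trans (Nat.dvd_of_mem_divisors hd))
  exact Nat.not_even_iff_odd.2 hm (even_iff_two_dvd.2 h2)

theorem filter_not_four_dvd_divisors_two_pow_mul (k : ℕ) {m : ℕ} (hm : Odd m) :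
    (2 ^ (k + 1) * m).divisors.filter (fun d => ¬ 4 ∣ d) = (2 * m).divisors := by
  have hm0 : m ≠ 0 := hm.pos.ne'
  have hodd : ∀ (l e : ℕ), Odd e → e ∣ 2 ^ l * m → e ∣ m := fun l e he h =>
    ((Nat.coprime_two_right.2 he).pow_right l).dvd_of_dvd_mul_left h
  ext d
  simp only [Finset.mem_filter, Nat.mem_divisors]
  constructor
  · rintro ⟨⟨h1, -⟩, h2⟩
    refine ⟨?_, by positivity⟩
    rcases Nat.even_or_odd' d with ⟨e, rfl | rfl⟩
    · have he : Odd e := by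
        rw [← Nat.not_even_iff_odd, even_iff_two_dvd]
        rintro ⟨f, rfl⟩
        exact h2 ⟨f, by ring⟩
      rw [pow_succ', mul_assoc] at h1
      exact mul_dvd_mul_left 2 (hodd k e he (Nat.dvd_of_mul_dvd_mul_left two_pos h1))
    · exact (hodd _ _ ⟨e, rfl⟩ h1).mul_left 2
  · rintro ⟨h1, -⟩
    refine ⟨⟨h1.trans (mul_dvd_mul_right (dvd_pow_self 2 k.succ_ne_zero) m), by positivity⟩, ?_⟩
    intro h
    obtain ⟨f, hf⟩ := h.trans h1
    obtain ⟨j, rfl⟩ := hm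
    lia

theorem sum_divisors_two_mul {m : ℕ} (hm : Odd m) :
    ∑ d ∈ (2 * m).divisors, d = 3 * ∑ d ∈ m.divisors, d := by
  rw [(Nat.coprime_two_left.2 hm).sum_divisors_mul, Nat.Prime.sum_divisors Nat.prime_two]

theorem jacobi_four_squares (n : ℕ) (hn : 0 < n) :
    Nat.card {x : Fin 4 → ℤ // (x 0)^2 + (x 1)^2 + (x 2)^2 + (x 3)^2 = n} =
      8 * ∑ d ∈ n.divisors.filter (fun d => ¬ (4 ∣ d)), d := by
  have hcard : Nat.card {x : Fin 4 → ℤ // (x 0)^2 + (x 1)^2 + (x 2)^2 + (x 3)^2 = n} =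
      (sqReps 4 n).card :=
    Nat.subtype_card _ fun x => by rw [mem_sqReps, Fin.sum_univ_four]
  rw [hcard]
  obtain ⟨k, m, hm, rfl⟩ := Nat.exists_eq_two_pow_mul_odd hn.ne'
  cases k with
  | zero =>
    rw [pow_zero, one_mul, filter_not_four_dvd_divisors_of_odd hm, card_sqReps_of_odd hm]
  | succ k =>
    rw [filter_not_four_dvd_divisors_two_pow_mul k hm, sum_divisors_two_mul hm]
    push_cast
    rw [card_sqReps_two_pow_mul k hm]
    ring
end

section
/- As an identity of formal power series in q: (∑_{k∈ℤ} q^{k^2})^4 = 1 + 8 ∑_{k=1}^{∞} q^k / (1 + (-q)^k)^2, where 1/(1+(-q)^k)^2 is interpreted as the power series ∑_{m≥0} (m+1)(-1)^m (-q)^{km}. -/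
open Filter Topology Finset

/-- The product `∏_{j < k} φ (n - j) / φ (n + 1 + j)`. When `φ 0 = 0` it vanishes for `k > n`; for
`φ i = 1 - q ^ i` it is a ratio of two `q`-binomial coefficients. -/
noncomputable def centralRatio (φ : ℕ → ℂ) (n k : ℕ) : ℂ := ∏ j ∈ range k, φ (n - j) / φ (n + 1 + j)

lemma centralRatio_succ (φ : ℕ → ℂ) (n k : ℕ) :
    centralRatio φ n (k + 1) = centralRatio φ n k * (φ (n - k) / φ (n + 1 + k)) :=
  prod_range_succ _ _

lemma centralRatio_eq_zero {φ : ℕ → ℂ} (h0 : φ 0 = 0) {n k : ℕ} (h : n < k) :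
    centralRatio φ n k = 0 :=
  prod_eq_zero (mem_range.2 h) (by simp [h0])

lemma centralRatio_succ_left {φ : ℕ → ℂ} (hφ : ∀ i, φ (i + 1) ≠ 0) (k d : ℕ) (n : ℕ)
    (hn : n + 1 = k + d) :
    φ (n + 1) ^ 2 * centralRatio φ n k =
      φ d * φ (n + 1 + k) * centralRatio φ (n + 1) k := by
  induction k generalizing d with
  | zero =>
    obtain rfl : d = n + 1 := by omega
    simp [centralRatio, sq]
  | succ k ih =>
    have h := ih (d + 1) (by omega)
    rw [centralRatio_succ, centralRatio_succ, show n - k = d by omega,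
      show n + 1 - k = d + 1 by omega, ← mul_assoc, h]
    have h1 : φ (n + 1 + k) ≠ 0 := by
      rw [show n + 1 + k = n + k + 1 by omega]; exact hφ _
    have h2 : φ (n + 1 + (k + 1)) ≠ 0 := hφ (n + 1 + k)
    rw [show n + 1 + 1 + k = n + 1 + (k + 1) by omega]
    field_simp

lemma norm_centralRatio_le {φ : ℕ → ℂ} (h0 : φ 0 = 0) {r C : ℝ} (hr0 : 0 ≤ r) (hr : r < 1)
    (hC : 0 ≤ C) (h1 : ∀ i, ‖φ i‖ ≤ Real.exp (C * r ^ i))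
    (h2 : ∀ i, ‖(φ i)⁻¹‖ ≤ Real.exp (C * r ^ i)) (n k : ℕ) :
    ‖centralRatio φ n k‖ ≤ Real.exp (C * (1 - r)⁻¹ + C * (1 - r)⁻¹) := by
  rcases lt_or_ge n k with h | h
  · rw [centralRatio_eq_zero h0 h, norm_zero]
    positivity
  have hsum (s : Finset ℕ) : ∑ j ∈ s, r ^ j ≤ (1 - r)⁻¹ := by
    rw [← tsum_geometric_of_lt_one hr0 hr]
    exact (summable_geometric_of_lt_one hr0 hr).sum_le_tsum s fun _ _ ↦ by positivity
  calc ‖centralRatio φ n k‖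
      ≤ ∏ j ∈ range k, Real.exp (C * r ^ (n - j) + C * r ^ j) := by
        rw [centralRatio, norm_prod]
        refine prod_le_prod (fun _ _ ↦ norm_nonneg _) fun j _ ↦ ?_
        rw [div_eq_mul_inv, norm_mul, Real.exp_add]
        refine mul_le_mul (h1 _) ((h2 _).trans ?_) (norm_nonneg _) (Real.exp_nonneg _)
        exact Real.exp_le_exp.2 (mul_le_mul_of_nonneg_left
          (pow_le_pow_of_le_one hr0 hr.le (by omega)) hC)
    _ = Real.exp (C * ∑ j ∈ range k, r ^ (n - j) + C * ∑ j ∈ range k, r ^ j) := by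
        rw [← Real.exp_sum, sum_add_distrib, mul_sum, mul_sum]
    _ ≤ _ := by
        have h3 : ∑ j ∈ range k, r ^ (n - j) ≤ (1 - r)⁻¹ := by
          calc ∑ j ∈ range k, r ^ (n - j) ≤ ∑ j ∈ range (n + 1), r ^ (n - j) :=
                sum_le_sum_of_subset_of_nonneg (by simpa using by omega)
                  fun _ _ _ ↦ by positivity
            _ = ∑ j ∈ range (n + 1), r ^ j := sum_flip fun j ↦ r ^ j
            _ ≤ _ := hsum _
        gcongr
        exact hsum _

lemma tendsto_sum_mul_centralRatio {φ : ℕ → ℂ} (h0 : φ 0 = 0) {r C : ℝ} (hr0 : 0 ≤ r)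
    (hr : r < 1) (hC : 0 ≤ C) (h1 : ∀ i, ‖φ i‖ ≤ Real.exp (C * r ^ i))
    (h2 : ∀ i, ‖(φ i)⁻¹‖ ≤ Real.exp (C * r ^ i)) (hlim : Tendsto φ atTop (𝓝 1))
    {t : ℕ → ℂ} (ht : Summable fun k ↦ ‖t k‖) :
    Tendsto (fun n ↦ ∑ k ∈ range n, t k * centralRatio φ n (k + 1)) atTop
      (𝓝 (∑' k, t k)) := by
  have key (n : ℕ) : ∑ k ∈ range n, t k * centralRatio φ n (k + 1) =
      ∑' k, t k * centralRatio φ n (k + 1) := by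
    refine (tsum_eq_sum fun k hk ↦ ?_).symm
    rw [centralRatio_eq_zero h0 (by simp at hk; omega), mul_zero]
  simp_rw [key]
  refine tendsto_tsum_of_dominated_convergence
    (ht.mul_right (Real.exp (C * (1 - r)⁻¹ + C * (1 - r)⁻¹))) (fun k ↦ ?_)
    (Eventually.of_forall fun n k ↦ ?_)
  · have h : Tendsto (fun n ↦ centralRatio φ n (k + 1)) atTop
        (𝓝 (∏ j ∈ range (k + 1), 1 / 1)) := by
      refine tendsto_finsetProd _ fun j _ ↦ ?_
      refine (hlim.comp (tendsto_sub_atTop_nat j)).div (hlim.comp ?_) one_ne_zero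
      exact tendsto_atTop_mono (fun n ↦ show n ≤ n + 1 + j by omega) tendsto_id
    simpa using h.const_mul (t k)
  · rw [norm_mul]
    exact mul_le_mul_of_nonneg_left (norm_centralRatio_le h0 hr0 hr hC h1 h2 _ _) (norm_nonneg _)

lemma one_sub_pow_succ_ne_zero {q : ℂ} (hq : ‖q‖ < 1) (i : ℕ) : 1 - q ^ (i + 1) ≠ 0 := by
  intro h
  have : ‖q ^ (i + 1)‖ < 1 := by
    rw [norm_pow]; exact pow_lt_one₀ (norm_nonneg _) hq (by omega)
  rw [← sub_eq_zero.1 h] at this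
  simp at this

lemma one_add_pow_ne_zero {q : ℂ} (hq : ‖q‖ < 1) (i : ℕ) : 1 + q ^ i ≠ 0 := by
  rcases i with _ | i
  · norm_num
  intro h
  have : ‖q ^ (i + 1)‖ < 1 := by
    rw [norm_pow]; exact pow_lt_one₀ (norm_nonneg _) hq (by omega)
  rw [eq_neg_of_add_eq_zero_right h] at this
  simp at this

/-- The finite form of Gauss's product formula for `∑ (-1) ^ k q ^ (k ^ 2)`. -/
lemma one_add_two_mul_sum_eq_prod {q : ℂ} (hq : ‖q‖ < 1) (n : ℕ) :
    1 + 2 * ∑ k ∈ range n,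
        (-1) ^ (k + 1) * q ^ ((k + 1) ^ 2) * centralRatio (fun i ↦ 1 - q ^ i) n (k + 1) =
      ∏ i ∈ range n, (1 - q ^ (i + 1)) / (1 + q ^ (i + 1)) := by
  set φ : ℕ → ℂ := fun i ↦ 1 - q ^ i with hφ
  have hne : ∀ i, φ (i + 1) ≠ 0 := one_sub_pow_succ_ne_zero hq
  induction n with
  | zero => simp
  | succ n ih =>
    have hN : 1 - q ^ (n + 1) ≠ 0 := one_sub_pow_succ_ne_zero hq n
    have hN' : 1 + q ^ (n + 1) ≠ 0 := one_add_pow_ne_zero hq _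
    have key (m d : ℕ) (hm : n + 1 = m + d) :
        (1 + q ^ (n + 1)) * (1 + 2 * ∑ k ∈ range m,
          (-1) ^ (k + 1) * q ^ ((k + 1) ^ 2) * centralRatio φ (n + 1) (k + 1)) -
        (1 - q ^ (n + 1)) * (1 + 2 * ∑ k ∈ range m,
          (-1) ^ (k + 1) * q ^ ((k + 1) ^ 2) * centralRatio φ n (k + 1)) =
        2 * ((-1) ^ m * q ^ (m ^ 2) * centralRatio φ (n + 1) m) *
          (q ^ (n + 1) * q ^ m * (1 - q ^ d)) / (1 - q ^ (n + 1)) := by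
      induction m generalizing d with
      | zero =>
        obtain rfl : d = n + 1 := by omega
        simp [centralRatio]
        field_simp
        ring
      | succ m ihm =>
        have h := ihm (d + 1) (by omega)
        have hrel := centralRatio_succ_left hne (m + 1) d n (by omega)
        have hstep := centralRatio_succ φ (n + 1) m
        rw [show n + 1 - m = d + 1 by omega] at hstep
        have hx : 1 - q ^ (n + 1 + 1 + m) ≠ 0 := by
          have := one_sub_pow_succ_ne_zero hq (n + 1 + m)
          rwa [show n + 1 + m + 1 = n + 1 + 1 + m by omega] at this
        rw [show n + 1 + (m + 1) = n + 1 + 1 + m by omega] at hrel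
        have hB : centralRatio φ (n + 1) m * (1 - q ^ (d + 1)) =
            centralRatio φ (n + 1) (m + 1) * (1 - q ^ (n + 1 + 1 + m)) := by
          rw [hstep]
          simp only [hφ]
          field_simp
        rw [sum_range_succ, sum_range_succ, eq_div_iff hN]
        rw [eq_div_iff hN] at h
        simp only [hφ] at h hrel hB ⊢
        have e1 : q ^ (n + 1 + 1 + m) = q ^ (n + 1) * (q * q ^ m) := by ring
        have e2 : q ^ (n + 1) = q ^ m * q * q ^ d := by rw [hm]; ring
        have e3 : q ^ ((m + 1) ^ 2) = q ^ (m ^ 2) * (q ^ m) ^ 2 * q := by ring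
        rw [e1] at hrel hB
        rw [e3, pow_succ (-1 : ℂ) m, pow_succ q m]
        rw [pow_succ q d] at h hB
        simp only [e2] at h hrel hB ⊢
        generalize q ^ m = x at *
        generalize q ^ d = y at *
        linear_combination h + 2 * ((-1) ^ m * q ^ (m ^ 2)) * (x * q * y) * x * hB +
          2 * (-1) ^ m * q ^ (m ^ 2) * x ^ 2 * q * hrel
    have h := key (n + 1) 0 (by omega)
    rw [sum_range_succ _ n, sum_range_succ _ n,
      centralRatio_eq_zero (n := n) (by simp [hφ]) (Nat.lt_succ_self n), mul_zero, add_zero, ih,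
      ← sum_range_succ] at h
    rw [prod_range_succ, mul_div_assoc', eq_div_iff hN']
    simp only [pow_zero, sub_self, mul_zero, zero_div] at h
    linear_combination h

/-- A finite form of Jacobi's four squares identity. -/
lemma one_add_eight_mul_sum_eq_prod_pow {q : ℂ} (hq : ‖q‖ < 1) (n : ℕ) :
    1 + 8 * ∑ k ∈ range n, (-q) ^ (k + 1) / (1 + q ^ (k + 1)) ^ 2 *
        centralRatio (fun i ↦ (1 - q ^ i) / (1 + q ^ i)) n (k + 1) =
      (∏ i ∈ range n, (1 - q ^ (i + 1)) / (1 + q ^ (i + 1))) ^ 4 := by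
  set φ : ℕ → ℂ := fun i ↦ (1 - q ^ i) / (1 + q ^ i) with hφ
  have hne : ∀ i, φ (i + 1) ≠ 0 := fun i ↦
    div_ne_zero (one_sub_pow_succ_ne_zero hq i) (one_add_pow_ne_zero hq _)
  induction n with
  | zero => simp
  | succ n ih =>
    have hN : 1 - q ^ (n + 1) ≠ 0 := one_sub_pow_succ_ne_zero hq n
    have hN' : 1 + q ^ (n + 1) ≠ 0 := one_add_pow_ne_zero hq _
    set α : ℂ := 2 * q ^ (n + 1) * (1 + (q ^ (n + 1)) ^ 2) * (1 + q ^ (n + 1)) /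
      (1 - q ^ (n + 1)) with hα
    have key (m d : ℕ) (hm : n + 1 = m + d) :
        (1 + q ^ (n + 1)) ^ 4 * (1 + 8 * ∑ k ∈ range m,
          (-q) ^ (k + 1) / (1 + q ^ (k + 1)) ^ 2 * centralRatio φ (n + 1) (k + 1)) -
        (1 - q ^ (n + 1)) ^ 4 * (1 + 8 * ∑ k ∈ range m,
          (-q) ^ (k + 1) / (1 + q ^ (k + 1)) ^ 2 * centralRatio φ n (k + 1)) =
        4 * (-1) ^ m * centralRatio φ (n + 1) m * α * φ d := by
      induction m generalizing d with
      | zero =>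
        obtain rfl : d = n + 1 := by omega
        simp [centralRatio, hα, hφ]
        field_simp
        ring
      | succ m ihm =>
        have h := ihm (d + 1) (by omega)
        have hrel := centralRatio_succ_left hne (m + 1) d n (by omega)
        have hstep := centralRatio_succ φ (n + 1) m
        rw [show n + 1 - m = d + 1 by omega] at hstep
        rw [show n + 1 + (m + 1) = n + 1 + 1 + m by omega] at hrel
        have hx : φ (n + 1 + 1 + m) ≠ 0 := by
          have := hne (n + 1 + m)
          rwa [show n + 1 + m + 1 = n + 1 + 1 + m by omega] at this
        have hB : centralRatio φ (n + 1) m * φ (d + 1) =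
            centralRatio φ (n + 1) (m + 1) * φ (n + 1 + 1 + m) := by
          rw [hstep]
          field_simp
        have hy : 1 + q ^ d ≠ 0 := one_add_pow_ne_zero hq _
        have hX : 1 + q ^ (m + 1) ≠ 0 := one_add_pow_ne_zero hq _
        have hNX : 1 + q ^ (n + 1 + 1 + m) ≠ 0 := one_add_pow_ne_zero hq _
        have hrel' : (1 - q ^ (n + 1)) ^ 2 * centralRatio φ n (m + 1) =
            (1 + q ^ (n + 1)) ^ 2 *
              (φ d * φ (n + 1 + 1 + m) * centralRatio φ (n + 1) (m + 1)) := by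
          rw [← hrel]
          simp only [hφ]
          field_simp
        have halg : α * φ (n + 1 + 1 + m) + α * φ d =
            2 * (q ^ (m + 1) / (1 + q ^ (m + 1)) ^ 2) * ((1 + q ^ (n + 1)) ^ 4 -
              (1 - q ^ (n + 1)) ^ 2 * (1 + q ^ (n + 1)) ^ 2 * (φ d * φ (n + 1 + 1 + m))) := by
          have e1 : q ^ (n + 1 + 1 + m) = q ^ (n + 1) * q ^ (m + 1) := by ring
          have e2 : q ^ (n + 1) = q ^ (m + 1) * q ^ d := by rw [hm]; ring
          simp only [hα, hφ]
          rw [e1] at hNX ⊢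
          rw [e2] at hNX hN hN' ⊢
          generalize q ^ (m + 1) = X at *
          generalize q ^ d = y at *
          have hNX' : 1 + X ^ 2 * y ≠ 0 := by convert hNX using 2; ring
          field_simp
          ring
        rw [sum_range_succ, sum_range_succ, neg_pow q, pow_succ (-1 : ℂ) m]
        linear_combination h + 4 * (-1) ^ m * α * hB +
          8 * (-1) ^ m * (q ^ (m + 1) / (1 + q ^ (m + 1)) ^ 2) * (1 - q ^ (n + 1)) ^ 2 * hrel' +
          4 * (-1) ^ m * centralRatio φ (n + 1) (m + 1) * halg
    have h := key (n + 1) 0 (by omega)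
    rw [sum_range_succ _ n, sum_range_succ _ n,
      centralRatio_eq_zero (n := n) (by simp [hφ]) (Nat.lt_succ_self n), mul_zero, add_zero, ih,
      ← sum_range_succ] at h
    rw [prod_range_succ, mul_pow, div_pow, mul_div_assoc', eq_div_iff (pow_ne_zero 4 hN')]
    simp only [hφ, pow_zero, sub_self, mul_zero, zero_div] at h
    linear_combination h

lemma tsum_int_pow_sq {q : ℂ} (hq : ‖q‖ < 1) :
    ∑' k : ℤ, q ^ (k ^ 2) = 1 + 2 * ∑' k : ℕ, q ^ ((k + 1) ^ 2) := by
  have hs : Summable fun k : ℕ ↦ q ^ (k ^ 2) := by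
    refine .of_norm_bounded (summable_geometric_of_lt_one (norm_nonneg q) hq) fun k ↦ ?_
    rw [norm_pow]
    exact pow_le_pow_of_le_one (norm_nonneg _) hq.le (Nat.le_self_pow (by norm_num) k)
  have hs' : Summable fun k : ℕ ↦ q ^ ((k + 1) ^ 2) :=
    (summable_nat_add_iff (f := fun k : ℕ ↦ q ^ (k ^ 2)) 1).2 hs
  have e1 (k : ℕ) : q ^ ((k : ℤ) ^ 2) = q ^ (k ^ 2) := by
    exact_mod_cast zpow_natCast q (k ^ 2)
  have e2 (k : ℕ) : q ^ ((-((k : ℤ) + 1)) ^ 2) = q ^ ((k + 1) ^ 2) := by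
    rw [neg_sq]
    exact_mod_cast zpow_natCast q ((k + 1) ^ 2)
  have h := tsum_of_nat_of_neg_add_one (f := fun k : ℤ ↦ q ^ (k ^ 2))
    (by simpa only [e1] using hs) (by simpa only [e2] using hs')
  simp only [e1, e2] at h
  rw [h, hs.tsum_eq_zero_add, zero_pow two_ne_zero, pow_zero]
  ring

lemma summable_norm_pow_succ_sq {q : ℂ} (hq : ‖q‖ < 1) :
    Summable fun k : ℕ ↦ ‖q ^ ((k + 1) ^ 2)‖ := by
  refine .of_nonneg_of_le (fun _ ↦ norm_nonneg _) (fun k ↦ ?_)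
    (summable_geometric_of_lt_one (norm_nonneg q) hq)
  rw [norm_pow]
  exact pow_le_pow_of_le_one (norm_nonneg _) hq.le (by nlinarith)

lemma one_sub_norm_le_norm_one_sub_pow {q : ℂ} (hq : ‖q‖ < 1) (i : ℕ) :
    1 - ‖q‖ ≤ ‖1 - q ^ (i + 1)‖ := by
  have h1 : ‖q ^ (i + 1)‖ ≤ ‖q‖ := by
    rw [norm_pow]; exact pow_le_of_le_one (norm_nonneg _) hq.le (by omega)
  have h2 := norm_sub_norm_le 1 (q ^ (i + 1))
  rw [norm_one] at h2
  linarith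

lemma one_sub_norm_le_norm_one_add_pow {q : ℂ} (hq : ‖q‖ < 1) (i : ℕ) :
    1 - ‖q‖ ≤ ‖1 + q ^ (i + 1)‖ := by
  have h1 : ‖q ^ (i + 1)‖ ≤ ‖q‖ := by
    rw [norm_pow]; exact pow_le_of_le_one (norm_nonneg _) hq.le (by omega)
  have h2 := norm_sub_le_norm_add 1 (q ^ (i + 1))
  rw [norm_one] at h2
  linarith

lemma norm_le_exp_of_sub_one_eq_div {a b z w : ℂ} {r C : ℝ} (ha : a = 1 + b * z / w)
    (hr : 0 < r) (hw : r ≤ ‖w‖) (hb : ‖b‖ ≤ C) : ‖a‖ ≤ Real.exp (C / r * ‖z‖) := by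
  have hC : 0 ≤ C := (norm_nonneg _).trans hb
  have h : ‖b * z / w‖ ≤ C / r * ‖z‖ := by
    rw [norm_div, norm_mul, div_mul_eq_mul_div]
    gcongr
  calc ‖a‖ ≤ ‖(1 : ℂ)‖ + ‖b * z / w‖ := ha ▸ norm_add_le _ _
    _ ≤ C / r * ‖z‖ + 1 := by rw [norm_one]; linarith
    _ ≤ _ := Real.add_one_le_exp _

lemma tendsto_prod_theta {q : ℂ} (hq : ‖q‖ < 1) :
    Tendsto (fun n ↦ ∏ i ∈ range n, (1 - q ^ (i + 1)) / (1 + q ^ (i + 1))) atTop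
      (𝓝 (1 + 2 * ∑' k : ℕ, (-1) ^ (k + 1) * q ^ ((k + 1) ^ 2))) := by
  simp_rw [← one_add_two_mul_sum_eq_prod hq]
  have hr : 0 < 1 - ‖q‖ := by linarith
  refine ((tendsto_sum_mul_centralRatio (by simp) (norm_nonneg q) hq
    (C := 1 / (1 - ‖q‖)) (by positivity) (fun i ↦ ?_) (fun i ↦ ?_) ?_ ?_).const_mul 2).const_add 1
  · rw [← norm_pow]
    exact norm_le_exp_of_sub_one_eq_div (b := -1) (w := 1) (by ring) hr (by simp) (by simp)
  · rw [← norm_pow]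
    rcases i with _ | i
    · simp [Real.exp_nonneg]
    have := one_sub_pow_succ_ne_zero hq i
    exact norm_le_exp_of_sub_one_eq_div (b := 1) (by field_simp; ring) hr
      (one_sub_norm_le_norm_one_sub_pow hq i) (by simp)
  · simpa using (tendsto_pow_atTop_nhds_zero_of_norm_lt_one hq).const_sub 1
  · simpa [norm_mul] using summable_norm_pow_succ_sq hq

lemma tendsto_prod_pow_four {q : ℂ} (hq : ‖q‖ < 1) :
    Tendsto (fun n ↦ (∏ i ∈ range n, (1 - q ^ (i + 1)) / (1 + q ^ (i + 1))) ^ 4) atTop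
      (𝓝 (1 + 8 * ∑' k : ℕ, (-q) ^ (k + 1) / (1 + q ^ (k + 1)) ^ 2)) := by
  simp_rw [← one_add_eight_mul_sum_eq_prod_pow hq]
  have hr : 0 < 1 - ‖q‖ := by linarith
  refine ((tendsto_sum_mul_centralRatio (by simp) (norm_nonneg q) hq
    (C := 2 / (1 - ‖q‖)) (by positivity) (fun i ↦ ?_) (fun i ↦ ?_) ?_ ?_).const_mul 8).const_add 1
  · rw [← norm_pow]
    rcases i with _ | i
    · simp [Real.exp_nonneg]
    have := one_add_pow_ne_zero hq (i + 1)
    exact norm_le_exp_of_sub_one_eq_div (b := -2) (by field_simp; ring) hr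
      (one_sub_norm_le_norm_one_add_pow hq i) (by simp)
  · rw [← norm_pow]
    rcases i with _ | i
    · simp [Real.exp_nonneg]
    have := one_sub_pow_succ_ne_zero hq i
    exact norm_le_exp_of_sub_one_eq_div (b := 2) (by field_simp; ring) hr
      (one_sub_norm_le_norm_one_sub_pow hq i) (by simp)
  · have h := tendsto_pow_atTop_nhds_zero_of_norm_lt_one hq
    simpa [Pi.div_def] using (h.const_sub 1).div (h.const_add 1) (by simp)
  · refine .of_nonneg_of_le (fun _ ↦ norm_nonneg _) (fun k ↦ ?_)
      ((summable_geometric_of_lt_one (norm_nonneg q) hq).div_const ((1 - ‖q‖) ^ 2))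
    rw [norm_div, norm_pow, norm_pow, norm_neg]
    gcongr ?_ / ?_ ^ 2
    · exact pow_le_pow_of_le_one (norm_nonneg _) hq.le (by omega)
    · exact one_sub_norm_le_norm_one_add_pow hq k

theorem jacobi_theta_identity (q : ℂ) (hq : ‖q‖ < 1) :
    (∑' k : ℤ, q^(k^2))^4 =
      1 + 8 * ∑' k : ℕ, q^(k+1) / (1 + (-q)^(k+1))^2 := by
  have hq' : ‖-q‖ < 1 := by rwa [norm_neg]
  have h := tendsto_nhds_unique ((tendsto_prod_theta hq').pow 4) (tendsto_prod_pow_four hq')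
  have hsign (k : ℕ) : (-1 : ℂ) ^ (k + 1) * (-q) ^ ((k + 1) ^ 2) = q ^ ((k + 1) ^ 2) := by
    rw [neg_pow q, ← mul_assoc, ← pow_add,
      show k + 1 + (k + 1) ^ 2 = (k + 1) * (k + 1 + 1) by ring,
      (Nat.even_mul_succ_self (k + 1)).neg_one_pow, one_mul]
  simp_rw [hsign, neg_neg] at h
  rw [tsum_int_pow_sq hq, h]
end

section
/- For complex q with |q| < 1, the infinite product ∏_{i=0}^{∞} (1-q^{5i+1})^{-1}(1-q^{5i+4})^{-1} converges and equals ∑_{r=0}^{∞} q^{r^2}/(q)_r, where (q)_r = ∏_{j=1}^{r}(1-q^j). -/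
open Filter Topology

/-- The reciprocal `1 / (q)_n` of the `q`-factorial `(q)_n = ∏_{j=1}^n (1 - q^j)`, extended by `0`
to negative integers `n`. -/
noncomputable def qFactorialInv (q : ℂ) (n : ℤ) : ℂ :=
  if n < 0 then 0 else (∏ j ∈ Finset.range n.toNat, (1 - q ^ (j + 1)))⁻¹

theorem qFactorialInv_of_neg (q : ℂ) {n : ℤ} (hn : n < 0) : qFactorialInv q n = 0 := if_pos hn

theorem qFactorialInv_natCast (q : ℂ) (n : ℕ) :
    qFactorialInv q n = (∏ j ∈ Finset.range n, (1 - q ^ (j + 1)))⁻¹ := by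
  simp [qFactorialInv]

theorem qFactorialInv_zero (q : ℂ) : qFactorialInv q 0 = 1 := by
  simp [qFactorialInv]

theorem one_sub_pow_ne_zero_of_norm_lt_one {q : ℂ} (hq : ‖q‖ < 1) {n : ℕ} (hn : n ≠ 0) :
    1 - q ^ n ≠ 0 := by
  intro h
  have h1 : ‖q ^ n‖ < 1 := by
    rw [norm_pow]
    exact pow_lt_one₀ (norm_nonneg _) hq hn
  rw [← sub_eq_zero.mp h, norm_one] at h1
  exact lt_irrefl _ h1

theorem one_sub_zpow_ne_zero_of_norm_lt_one {q : ℂ} (hq : ‖q‖ < 1) {n : ℤ} (hn : 0 < n) :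
    1 - q ^ n ≠ 0 := by
  lift n to ℕ using hn.le
  rw [zpow_natCast]
  exact one_sub_pow_ne_zero_of_norm_lt_one hq (by lia)

theorem qFactorialInv_sub_one {q : ℂ} (hq : ‖q‖ < 1) (n : ℤ) :
    qFactorialInv q (n - 1) = (1 - q ^ n) * qFactorialInv q n := by
  rcases lt_trichotomy n 0 with hn | rfl | hn
  · simp [qFactorialInv_of_neg q hn, qFactorialInv_of_neg q (show n - 1 < 0 by lia)]
  · simp [qFactorialInv_of_neg]
  · obtain ⟨k, rfl⟩ : ∃ k : ℕ, n = k + 1 := ⟨(n - 1).toNat, by lia⟩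
    have h := one_sub_zpow_ne_zero_of_norm_lt_one hq hn
    have h' : (k : ℤ) + 1 = ((k + 1 : ℕ) : ℤ) := by push_cast; rfl
    rw [add_sub_cancel_right, h', qFactorialInv_natCast, qFactorialInv_natCast,
      Finset.prod_range_succ, zpow_natCast, mul_inv]
    rw [h', zpow_natCast] at h
    field_simp

theorem qFactorialInv_eq_mul_add_one {q : ℂ} (hq : ‖q‖ < 1) (n : ℤ) :
    qFactorialInv q n = (1 - q ^ (n + 1)) * qFactorialInv q (n + 1) := by
  simpa using qFactorialInv_sub_one hq (n + 1)

theorem summable_of_eq_zero_of_lt_abs {f : ℤ → ℂ} (n : ℤ) (hf : ∀ m, n < |m| → f m = 0) :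
    Summable f := by
  refine summable_of_hasFiniteSupport ((Set.finite_Icc (-n) n).subset fun m hm ↦ ?_)
  by_contra h
  refine hm (hf m ?_)
  by_contra h'
  exact h (abs_le.mp (not_lt.mp h'))

theorem qFactorialInv_mul_eq_zero (q : ℂ) {n m : ℤ} (h : n < |m|) :
    qFactorialInv q (n - m) * qFactorialInv q (n + m) = 0 := by
  rcases lt_abs.mp h with h | h
  · rw [qFactorialInv_of_neg q (by lia), zero_mul]
  · rw [qFactorialInv_of_neg q (n := n + m) (by lia), mul_zero]

theorem summable_mul_qFactorialInv (q : ℂ) (a : ℤ → ℂ) (n : ℤ) :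
    Summable fun m ↦ a m * (qFactorialInv q (n - m) * qFactorialInv q (n + m)) :=
  summable_of_eq_zero_of_lt_abs n fun m hm ↦ by rw [qFactorialInv_mul_eq_zero q hm, mul_zero]

theorem two_mul_mul_sub_one_ediv_two (m : ℤ) : 2 * (m * (m - 1) / 2) = m * (m - 1) :=
  Int.two_mul_ediv_two_of_even (Int.even_mul_pred_self m)

theorem summable_int_add_right {f : ℤ → ℂ} (hf : Summable f) (k : ℤ) :
    Summable fun m ↦ f (m + k) :=
  hf.comp_injective (add_left_injective k)

theorem tsum_int_add_right (f : ℤ → ℂ) (k : ℤ) : ∑' m, f (m + k) = ∑' m, f m :=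
  (Equiv.addRight k).tsum_eq f

/-- A finite form of the Jacobi triple product identity. -/
theorem tsum_zpow_mul_qFactorialInv {q : ℂ} (hq : ‖q‖ < 1) (hq0 : q ≠ 0) {w : ℂ} (hw : w ≠ 0)
    (n : ℕ) :
    ∑' m : ℤ, w ^ m * q ^ (m * (m - 1) / 2) *
      (qFactorialInv q (n - m) * qFactorialInv q (n + m)) =
    qFactorialInv q (2 * n) *
      ∏ j ∈ Finset.range n, ((1 + w * q ^ j) * (1 + q ^ (j + 1) / w)) := by
  induction n with
  | zero =>
    rw [tsum_eq_single 0]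
    · simp [qFactorialInv_zero]
    · intro m hm
      rw [qFactorialInv_mul_eq_zero q (by simpa using hm), mul_zero]
  | succ n ih =>
    set a : ℤ → ℂ := fun m ↦ w ^ m * q ^ (m * (m - 1) / 2) with ha
    set t : ℤ → ℂ := fun m ↦ a m * (qFactorialInv q (n - m) * qFactorialInv q (n + m)) with ht
    have hst : Summable t := summable_mul_qFactorialInv q a n
    have hdown (m : ℤ) : w * q ^ n * t (m - 1) =
        a m * (q ^ ((n : ℤ) + 1 - m) * (qFactorialInv q (n - m + 1) *
          qFactorialInv q (n + m - 1))) := by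
      have h : (m - 1) * (m - 1 - 1) / 2 = m * (m - 1) / 2 - (m - 1) := by
        linarith [two_mul_mul_sub_one_ediv_two m, two_mul_mul_sub_one_ediv_two (m - 1)]
      simp only [ht, ha]
      rw [h, zpow_sub₀ hq0, zpow_sub_one₀ hw, show (n : ℤ) + 1 - m = n - (m - 1) by ring,
        zpow_sub₀ hq0 n, zpow_natCast, show (n : ℤ) - m + 1 = n - (m - 1) by ring,
        show (n : ℤ) + m - 1 = n + (m - 1) by ring]
      field_simp
    have hup (m : ℤ) : q ^ (n + 1) / w * t (m + 1) =
        a m * (q ^ ((n : ℤ) + 1 + m) * (qFactorialInv q (n - m - 1) *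
          qFactorialInv q (n + m + 1))) := by
      have h : (m + 1) * (m + 1 - 1) / 2 = m * (m - 1) / 2 + m := by
        linarith [two_mul_mul_sub_one_ediv_two m, two_mul_mul_sub_one_ediv_two (m + 1)]
      simp only [ht, ha]
      rw [h, zpow_add₀ hq0, zpow_add_one₀ hw, zpow_add₀ hq0,
        show (n : ℤ) + 1 = ((n + 1 : ℕ) : ℤ) by push_cast; rfl, zpow_natCast,
        show (n : ℤ) - m - 1 = n - (m + 1) by ring,
        show (n : ℤ) + m + 1 = n + (m + 1) by ring]
      field_simp
    have hs₁ : Summable fun m ↦ t (m - 1) := summable_int_add_right hst (-1)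
    have hs₂ : Summable fun m ↦ t (m + 1) := summable_int_add_right hst 1
    have hsub : ∑' m, t (m - 1) = ∑' m, t m := tsum_int_add_right t (-1)
    have hadd : ∑' m, t (m + 1) = ∑' m, t m := tsum_int_add_right t 1
    have hkey (m : ℤ) : (1 - q ^ (2 * (n : ℤ) + 1)) * (1 - q ^ (2 * (n : ℤ) + 2)) *
        (a m * (qFactorialInv q ((n + 1 : ℕ) - m) * qFactorialInv q ((n + 1 : ℕ) + m))) =
        (1 + q ^ (2 * n + 1)) * t m + w * q ^ n * t (m - 1) + q ^ (n + 1) / w * t (m + 1) := by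
      rw [hdown, hup]
      simp only [ht]
      have e₁ := qFactorialInv_eq_mul_add_one hq (n - m)
      have e₂ := qFactorialInv_eq_mul_add_one hq (n + m)
      have e₃ := qFactorialInv_sub_one hq (n - m)
      have e₄ := qFactorialInv_sub_one hq (n + m)
      rw [e₃, e₄, e₁, e₂]
      rw [show ((n + 1 : ℕ) : ℤ) - m = n - m + 1 by push_cast; ring,
        show ((n + 1 : ℕ) : ℤ) + m = n + m + 1 by push_cast; ring,
        show (2 * (n : ℤ) + 1) = (n - m) + (n + m) + 1 by ring,
        show (2 * (n : ℤ) + 2) = (n - m) + (n + m) + 1 + 1 by ring,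
        show (n : ℤ) + 1 - m = n - m + 1 by ring, show (n : ℤ) + 1 + m = n + m + 1 by ring]
      have hn : q ^ (2 * n + 1) = q ^ ((n : ℤ) - m) * q ^ ((n : ℤ) + m) * q := by
        rw [← zpow_add₀ hq0, ← zpow_add_one₀ hq0, ← zpow_natCast]
        congr 1
        push_cast
        ring
      rw [hn]
      simp only [zpow_add_one₀ hq0]
      rw [zpow_add₀ hq0 ((n : ℤ) - m)]
      ring
    have hsum : (1 - q ^ (2 * (n : ℤ) + 1)) * (1 - q ^ (2 * (n : ℤ) + 2)) *
        ∑' m : ℤ, a m * (qFactorialInv q ((n + 1 : ℕ) - m) * qFactorialInv q ((n + 1 : ℕ) + m)) =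
        (1 + w * q ^ n) * (1 + q ^ (n + 1) / w) * ∑' m, t m := by
      rw [← tsum_mul_left, tsum_congr hkey,
        Summable.tsum_add ((hst.mul_left _).add (hs₁.mul_left _)) (hs₂.mul_left _),
        Summable.tsum_add (hst.mul_left _) (hs₁.mul_left _), tsum_mul_left, tsum_mul_left,
        tsum_mul_left, hsub, hadd]
      field_simp
      ring
    have h₁ := one_sub_zpow_ne_zero_of_norm_lt_one hq (n := 2 * (n : ℤ) + 1) (by lia)
    have h₂ := one_sub_zpow_ne_zero_of_norm_lt_one hq (n := 2 * (n : ℤ) + 2) (by lia)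
    refine mul_left_cancel₀ (mul_ne_zero h₁ h₂) (hsum.trans ?_)
    rw [ih, qFactorialInv_eq_mul_add_one hq, qFactorialInv_eq_mul_add_one hq (2 * (n : ℤ) + 1),
      Finset.prod_range_succ, show 2 * (n : ℤ) + 1 + 1 = 2 * n + 2 by ring,
      show 2 * ((n + 1 : ℕ) : ℤ) = 2 * n + 2 by push_cast; ring]
    ring

/-- A `q`-analogue of Vandermonde's identity. -/
theorem tsum_zpow_sq_mul_qFactorialInv {q : ℂ} (hq : ‖q‖ < 1) (hq0 : q ≠ 0) (n m : ℤ) :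
    ∑' s : ℤ, q ^ (s ^ 2) * qFactorialInv q (n - s) *
      (qFactorialInv q (s - m) * qFactorialInv q (s + m)) =
    q ^ (m ^ 2) * (qFactorialInv q (n - m) * qFactorialInv q (n + m)) := by
  wlog hm : 0 ≤ m generalizing m
  · have h := this (-m) (by lia)
    simp only [sub_neg_eq_add, ← sub_eq_add_neg, neg_sq] at h
    simpa only [mul_comm (qFactorialInv q (_ + m))] using h
  set t : ℤ → ℤ → ℂ := fun n s ↦ q ^ (s ^ 2) * qFactorialInv q (n - s) *
      (qFactorialInv q (s - m) * qFactorialInv q (s + m)) with ht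
  have hts (n s : ℤ) (hs : s < m ∨ n < s) : t n s = 0 := by
    rcases hs with hs | hs
    · simp only [ht]
      rw [qFactorialInv_of_neg q (n := s - m) (by lia)]
      ring
    · simp only [ht]
      rw [qFactorialInv_of_neg q (n := n - s) (by lia)]
      ring
  have hst (n : ℤ) : Summable (t n) := by
    refine summable_of_hasFiniteSupport ((Set.finite_Icc m n).subset fun s hs ↦ ?_)
    by_contra h
    refine hs (hts n s ?_)
    rw [Set.mem_Icc] at h
    lia
  rcases lt_or_ge n m with hnm | hnm
  · rw [qFactorialInv_of_neg q (n := n - m) (by lia), zero_mul, mul_zero]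
    convert tsum_zero with s
    exact hts n s (by lia)
  change ∑' s, t n s = _
  induction n, hnm using Int.leInduction with
  | base =>
    rw [tsum_eq_single m fun s hs ↦ hts m s (by lia)]
    simp [ht, qFactorialInv_zero]
  | succ n hnm ih =>
    set G : ℤ → ℂ := fun s ↦ -q ^ (n + 1 - s) * (1 - q ^ (s - m)) * (1 - q ^ (s + m)) *
      t (n + 1) s with hG
    have hkey (s : ℤ) : (1 - q ^ (n + 1 - m)) * (1 - q ^ (n + 1 + m)) * t (n + 1) s =
        t n s + (G (s + 1) - G s) := by
      simp only [hG, ht]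
      have e₁ := qFactorialInv_sub_one hq (n + 1 - s)
      have e₂ := qFactorialInv_eq_mul_add_one hq (s - m)
      have e₃ := qFactorialInv_eq_mul_add_one hq (s + m)
      rw [show n + 1 - s - 1 = n - s by ring] at e₁
      rw [show n + 1 - (s + 1) = n - s by ring, show s + 1 - m = s - m + 1 by ring,
        show s + 1 + m = s + m + 1 by ring, e₁, e₂, e₃]
      rw [show (s + 1) ^ 2 = s ^ 2 + (s - m) + (s + m) + 1 by ring,
        show n + 1 - m = (n - s) + (s - m) + 1 by ring,
        show n + 1 + m = (n - s) + (s + m) + 1 by ring,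
        show n + 1 - s = n - s + 1 by ring]
      simp only [zpow_add_one₀ hq0]
      simp only [zpow_add₀ hq0 (_ + _), zpow_add₀ hq0 (n - s), zpow_add₀ hq0 (s ^ 2)]
      ring
    have hsG : Summable G := by
      refine summable_of_hasFiniteSupport ((Set.finite_Icc m (n + 1)).subset fun s hs ↦ ?_)
      by_contra h
      refine hs ?_
      simp only [hG]
      rw [hts (n + 1) s (by rw [Set.mem_Icc] at h; lia), mul_zero]
    have hsG' : Summable fun s ↦ G (s + 1) := summable_int_add_right hsG 1
    have hshift : ∑' s, G (s + 1) = ∑' s, G s := tsum_int_add_right G 1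
    have h₁ := one_sub_zpow_ne_zero_of_norm_lt_one hq (n := n + 1 - m) (by lia)
    have h₂ := one_sub_zpow_ne_zero_of_norm_lt_one hq (n := n + 1 + m) (by lia)
    refine mul_left_cancel₀ (mul_ne_zero h₁ h₂) ?_
    rw [← tsum_mul_left, tsum_congr hkey, Summable.tsum_add (hst n) (hsG'.sub hsG),
      Summable.tsum_sub hsG' hsG, hshift, sub_self, add_zero, ih]
    have e₁ := qFactorialInv_sub_one hq (n + 1 - m)
    have e₂ := qFactorialInv_sub_one hq (n + 1 + m)
    rw [show n + 1 - m - 1 = n - m by ring] at e₁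
    rw [show n + 1 + m - 1 = n + m by ring] at e₂
    rw [e₁, e₂]
    ring

/-- The case `a = 1` of Bailey's lemma. -/
theorem tsum_bailey {q : ℂ} (hq : ‖q‖ < 1) (hq0 : q ≠ 0) (a : ℤ → ℂ) (n : ℤ) :
    ∑' m : ℤ, q ^ (m ^ 2) * a m * (qFactorialInv q (n - m) * qFactorialInv q (n + m)) =
    ∑' s : ℤ, q ^ (s ^ 2) * qFactorialInv q (n - s) *
      ∑' m : ℤ, a m * (qFactorialInv q (s - m) * qFactorialInv q (s + m)) := by
  simp only [← tsum_mul_left]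
  rw [Summable.tsum_comm]
  · refine tsum_congr fun m ↦ ?_
    rw [mul_comm (q ^ _), mul_assoc, ← tsum_zpow_sq_mul_qFactorialInv hq hq0, ← tsum_mul_left]
    exact tsum_congr fun s ↦ by ring
  · refine summable_of_hasFiniteSupport
      (((Set.finite_Icc (-n) n).prod (Set.finite_Icc (-n) n)).subset fun ⟨m, s⟩ h ↦ ?_)
    by_contra h'
    refine h ?_
    simp only [Function.uncurry_apply_pair]
    rcases lt_or_ge n s with hns | hns
    · rw [qFactorialInv_of_neg q (n := n - s) (by lia)]
      ring
    rcases lt_or_ge s |m| with hsm | hsm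
    · rw [qFactorialInv_mul_eq_zero q hsm]
      ring
    · refine absurd ?_ h'
      rw [abs_le] at hsm
      simp only [Set.mem_prod, Set.mem_Icc]
      lia

/-- A finite form of the first Rogers–Ramanujan identity. -/
theorem tsum_zpow_sq_mul_qFactorialInv_mul {q : ℂ} (hq : ‖q‖ < 1) (hq0 : q ≠ 0) (n : ℤ) :
    ∑' s : ℤ, q ^ (s ^ 2) * (qFactorialInv q (n - s) * qFactorialInv q s) =
    ∑' m : ℤ, (-1) ^ m * q ^ (2 * m ^ 2 + m * (m - 1) / 2) *
      (qFactorialInv q (n - m) * qFactorialInv q (n + m)) := by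
  have h₀ (t : ℤ) : ∑' m : ℤ, (-1) ^ m * q ^ (m * (m - 1) / 2) *
      (qFactorialInv q (t - m) * qFactorialInv q (t + m)) = if t = 0 then 1 else 0 := by
    rcases lt_or_ge t 0 with ht | ht
    · rw [if_neg ht.ne]
      convert tsum_zero with m
      rw [qFactorialInv_mul_eq_zero q (ht.trans_le (abs_nonneg m)), mul_zero]
    · lift t to ℕ using ht
      rw [tsum_zpow_mul_qFactorialInv hq hq0 (by norm_num)]
      cases t with
      | zero => simp [qFactorialInv_zero]
      | succ t =>
        rw [Finset.prod_range_succ', if_neg (by lia)]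
        simp
  have h₁ (s : ℤ) : ∑' m : ℤ, q ^ (m ^ 2) * ((-1) ^ m * q ^ (m * (m - 1) / 2)) *
      (qFactorialInv q (s - m) * qFactorialInv q (s + m)) = qFactorialInv q s := by
    rw [tsum_bailey hq hq0]
    simp only [h₀]
    rw [tsum_eq_single 0 fun t ht ↦ by simp [ht]]
    simp
  have h₂ := tsum_bailey hq hq0 (fun m ↦ q ^ (m ^ 2) * ((-1) ^ m * q ^ (m * (m - 1) / 2))) n
  simp only [h₁] at h₂
  simp only [← mul_assoc] at h₂ ⊢
  rw [← h₂]
  refine tsum_congr fun m ↦ ?_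
  rw [zpow_add₀ hq0, two_mul, zpow_add₀ hq0]
  ring

theorem summable_norm_pow_mul_add {q : ℂ} (hq : ‖q‖ < 1) {k : ℕ} (hk : k ≠ 0) (l : ℕ) :
    Summable fun i : ℕ ↦ ‖q ^ (k * i + l)‖ := by
  have h : ‖q‖ ^ k < 1 := pow_lt_one₀ (norm_nonneg _) hq hk
  simpa [pow_add, pow_mul] using
    (summable_geometric_of_lt_one (by positivity) h).mul_right (‖q‖ ^ l)

theorem multipliable_one_sub_pow_mul_add {q : ℂ} (hq : ‖q‖ < 1) {k : ℕ} (hk : k ≠ 0) (l : ℕ) :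
    Multipliable fun i : ℕ ↦ 1 - q ^ (k * i + l) := by
  have h := summable_norm_pow_mul_add hq hk l
  simpa only [sub_eq_add_neg] using multipliable_one_add_of_summable
    (f := fun i : ℕ ↦ -q ^ (k * i + l)) (by simpa only [norm_neg] using h)

theorem tprod_one_sub_pow_mul_add_ne_zero {q : ℂ} (hq : ‖q‖ < 1) {k l : ℕ} (hk : k ≠ 0)
    (hl : l ≠ 0) : ∏' i : ℕ, (1 - q ^ (k * i + l)) ≠ 0 := by
  have h := tprod_one_add_ne_zero_of_summable (f := fun i : ℕ ↦ -q ^ (k * i + l))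
    (fun i ↦ by
      rw [← sub_eq_add_neg]
      exact one_sub_pow_ne_zero_of_norm_lt_one hq (by lia))
    (by simpa only [norm_neg] using summable_norm_pow_mul_add hq hk l)
  simpa only [sub_eq_add_neg] using h

theorem tendsto_qFactorialInv {q : ℂ} (hq : ‖q‖ < 1) :
    Tendsto (qFactorialInv q) atTop (𝓝 (∏' i : ℕ, (1 - q ^ (i + 1)))⁻¹) := by
  have h₁ := (multipliable_one_sub_pow_mul_add hq one_ne_zero 1).tendsto_prod_tprod_nat.inv₀
    (tprod_one_sub_pow_mul_add_ne_zero hq one_ne_zero one_ne_zero)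
  simp only [one_mul] at h₁
  have h₂ : Tendsto Int.toNat atTop atTop :=
    tendsto_atTop.mpr fun b ↦ (eventually_ge_atTop (b : ℤ)).mono fun n hn ↦ by lia
  refine (h₁.comp h₂).congr' ((eventually_ge_atTop 0).mono fun n hn ↦ ?_)
  simp [qFactorialInv, not_lt.mpr hn]

theorem exists_norm_qFactorialInv_le {q : ℂ} (hq : ‖q‖ < 1) :
    ∃ C : ℝ, ∀ n, ‖qFactorialInv q n‖ ≤ C := by
  obtain ⟨C, hC⟩ := (Metric.isBounded_range_of_tendsto _
    ((tendsto_qFactorialInv hq).comp tendsto_natCast_atTop_atTop)).exists_norm_le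
  refine ⟨C, fun n ↦ ?_⟩
  have hCn (k : ℕ) : ‖qFactorialInv q k‖ ≤ C := hC _ ⟨k, rfl⟩
  rcases lt_or_ge n 0 with hn | hn
  · rw [qFactorialInv_of_neg q hn, norm_zero]
    exact (norm_nonneg _).trans (hCn 0)
  · lift n to ℕ using hn
    exact hCn n

theorem tendsto_natCast_add_int (m : ℤ) : Tendsto (fun n : ℕ ↦ (n : ℤ) + m) atTop atTop :=
  tendsto_atTop_add_const_right _ m tendsto_natCast_atTop_atTop

theorem tendsto_tsum_mul_qFactorialInv {q : ℂ} (hq : ‖q‖ < 1) {a : ℤ → ℂ}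
    (ha : Summable fun m ↦ ‖a m‖) :
    Tendsto (fun n : ℕ ↦ ∑' m : ℤ, a m * (qFactorialInv q (n - m) * qFactorialInv q (n + m)))
      atTop (𝓝 ((∑' m, a m) *
        ((∏' i : ℕ, (1 - q ^ (i + 1)))⁻¹ * (∏' i : ℕ, (1 - q ^ (i + 1)))⁻¹))) := by
  obtain ⟨C, hC⟩ := exists_norm_qFactorialInv_le hq
  have hC0 : 0 ≤ C := (norm_nonneg _).trans (hC 0)
  rw [← tsum_mul_right]
  refine tendsto_tsum_of_dominated_convergence (ha.mul_right (C * C)) (fun m ↦ ?_)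
    (.of_forall fun n m ↦ ?_)
  · have h₁ := (tendsto_qFactorialInv hq).comp (tendsto_natCast_add_int (-m))
    have h₂ := (tendsto_qFactorialInv hq).comp (tendsto_natCast_add_int m)
    exact (h₁.mul h₂).const_mul (a m)
  · rw [norm_mul, norm_mul]
    gcongr
    exacts [hC _, hC _]

theorem tendsto_tsum_mul_qFactorialInv_sub {q : ℂ} (hq : ‖q‖ < 1) {a : ℤ → ℂ}
    (ha : Summable fun m ↦ ‖a m‖) :
    Tendsto (fun n : ℕ ↦ ∑' m : ℤ, a m * (qFactorialInv q (n - m) * qFactorialInv q m))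
      atTop (𝓝 ((∑' m, a m * qFactorialInv q m) * (∏' i : ℕ, (1 - q ^ (i + 1)))⁻¹)) := by
  obtain ⟨C, hC⟩ := exists_norm_qFactorialInv_le hq
  have hC0 : 0 ≤ C := (norm_nonneg _).trans (hC 0)
  rw [← tsum_mul_right]
  refine tendsto_tsum_of_dominated_convergence (ha.mul_right (C * C)) (fun m ↦ ?_)
    (.of_forall fun n m ↦ ?_)
  · have h₁ := (tendsto_qFactorialInv hq).comp (tendsto_natCast_add_int (-m))
    rw [mul_assoc, mul_comm (qFactorialInv q m)]
    exact (h₁.mul_const (qFactorialInv q m)).const_mul (a m)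
  · rw [norm_mul, norm_mul]
    gcongr
    exacts [hC _, hC _]

theorem summable_norm_zpow {q : ℂ} (hq : ‖q‖ < 1) (hq0 : q ≠ 0) {f : ℤ → ℤ}
    (hf : ∀ m, |m| ≤ f m) : Summable fun m ↦ ‖q ^ f m‖ := by
  have h : Summable fun m : ℤ ↦ ‖q‖ ^ |m| := by
    refine summable_int_iff_summable_nat_and_neg.mpr ⟨?_, ?_⟩ <;>
      simpa using summable_geometric_of_lt_one (norm_nonneg _) hq
  refine h.of_nonneg_of_le (fun _ ↦ norm_nonneg _) fun m ↦ ?_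
  rw [norm_zpow]
  exact zpow_le_zpow_right_of_le_one₀ (norm_pos_iff.mpr hq0) hq.le (hf m)

theorem abs_le_sq_int (m : ℤ) : |m| ≤ m ^ 2 := by
  rw [← sq_abs]
  exact Int.le_self_sq _

theorem abs_le_two_mul_sq_add (m : ℤ) : |m| ≤ 2 * m ^ 2 + m * (m - 1) / 2 := by
  have h := two_mul_mul_sub_one_ediv_two m
  have h' := abs_le_sq_int m
  have := neg_abs_le m
  have := le_abs_self m
  nlinarith

theorem tsum_neg_one_zpow_mul_zpow {q : ℂ} (hq : ‖q‖ < 1) (hq0 : q ≠ 0) :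
    ∑' m : ℤ, (-1) ^ m * q ^ (2 * m ^ 2 + m * (m - 1) / 2) =
      (∏' i : ℕ, (1 - q ^ (5 * i + 5))) *
        ((∏' i : ℕ, (1 - q ^ (5 * i + 2))) * ∏' i : ℕ, (1 - q ^ (5 * i + 3))) := by
  have hq5 : ‖q ^ 5‖ < 1 := by
    rw [norm_pow]
    exact pow_lt_one₀ (norm_nonneg _) hq (by norm_num)
  have hE : ∏' i : ℕ, (1 - (q ^ 5) ^ (i + 1)) = ∏' i : ℕ, (1 - q ^ (5 * i + 5)) :=
    tprod_congr fun i ↦ by rw [← pow_mul, mul_add_one]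
  have hE0 := tprod_one_sub_pow_mul_add_ne_zero hq (k := 5) (l := 5) (by norm_num) (by norm_num)
  have ha : Summable fun m : ℤ ↦ ‖(-1) ^ m * q ^ (2 * m ^ 2 + m * (m - 1) / 2)‖ := by
    simpa using summable_norm_zpow hq hq0 abs_le_two_mul_sq_add
  have h₁ := tendsto_tsum_mul_qFactorialInv hq5 ha
  have hterm (m : ℤ) : (-1) ^ m * q ^ (2 * m ^ 2 + m * (m - 1) / 2) =
      (-q ^ 2) ^ m * (q ^ 5) ^ (m * (m - 1) / 2) := by
    rw [neg_eq_neg_one_mul (q ^ 2), mul_zpow, ← zpow_natCast, ← zpow_natCast, ← zpow_mul,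
      ← zpow_mul, mul_assoc, ← zpow_add₀ hq0]
    congr 2
    push_cast
    linarith [two_mul_mul_sub_one_ediv_two m]
  have hfin (n : ℕ) : ∑' m : ℤ, (-1) ^ m * q ^ (2 * m ^ 2 + m * (m - 1) / 2) *
      (qFactorialInv (q ^ 5) (n - m) * qFactorialInv (q ^ 5) (n + m)) =
      qFactorialInv (q ^ 5) (2 * n) * ((∏ i ∈ Finset.range n, (1 - q ^ (5 * i + 2))) *
        ∏ i ∈ Finset.range n, (1 - q ^ (5 * i + 3))) := by
    simp only [hterm]
    rw [tsum_zpow_mul_qFactorialInv hq5 (pow_ne_zero 5 hq0) (neg_ne_zero.mpr (pow_ne_zero 2 hq0)),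
      ← Finset.prod_mul_distrib]
    congr 1
    refine Finset.prod_congr rfl fun j _ ↦ ?_
    congr 1
    · ring
    · field_simp
      ring
  simp only [hfin, hE] at h₁
  have h₂ : Tendsto (fun n : ℕ ↦ qFactorialInv (q ^ 5) (2 * n)) atTop
      (𝓝 (∏' i : ℕ, (1 - q ^ (5 * i + 5)))⁻¹) := by
    rw [← hE]
    exact (tendsto_qFactorialInv hq5).comp
      (tendsto_natCast_atTop_atTop.const_mul_atTop' (by norm_num))
  have h := tendsto_nhds_unique h₁ (h₂.mul
    ((multipliable_one_sub_pow_mul_add hq (k := 5) (by norm_num) 2).tendsto_prod_tprod_nat.mul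
      (multipliable_one_sub_pow_mul_add hq (k := 5) (by norm_num) 3).tendsto_prod_tprod_nat))
  field_simp at h
  rw [h]
  ring

theorem tsum_zpow_sq_mul_qFactorialInv_eq {q : ℂ} (hq : ‖q‖ < 1) (hq0 : q ≠ 0) :
    ∑' s : ℤ, q ^ (s ^ 2) * qFactorialInv q s =
      (∏' i : ℕ, (1 - q ^ (i + 1)))⁻¹ * ((∏' i : ℕ, (1 - q ^ (5 * i + 5))) *
        ((∏' i : ℕ, (1 - q ^ (5 * i + 2))) * ∏' i : ℕ, (1 - q ^ (5 * i + 3)))) := by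
  have h₁ := tendsto_tsum_mul_qFactorialInv_sub hq (a := fun s ↦ q ^ (s ^ 2))
    (summable_norm_zpow hq hq0 abs_le_sq_int)
  have h₂ := tendsto_tsum_mul_qFactorialInv hq
    (a := fun m ↦ (-1) ^ m * q ^ (2 * m ^ 2 + m * (m - 1) / 2))
    (by simpa using summable_norm_zpow hq hq0 abs_le_two_mul_sq_add)
  simp only [tsum_zpow_sq_mul_qFactorialInv_mul hq hq0] at h₁
  have hE0 : ∏' i : ℕ, (1 - q ^ (i + 1)) ≠ 0 := by
    simpa using tprod_one_sub_pow_mul_add_ne_zero hq (k := 1) (l := 1) one_ne_zero one_ne_zero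
  have h := tendsto_nhds_unique h₁ h₂
  rw [tsum_neg_one_zpow_mul_zpow hq hq0, ← mul_assoc] at h
  rw [mul_right_cancel₀ (inv_ne_zero hE0) h, mul_comm]

theorem tsum_zpow_sq_mul_qFactorialInv_eq_tsum_nat (q : ℂ) :
    ∑' s : ℤ, q ^ (s ^ 2) * qFactorialInv q s =
      ∑' r : ℕ, q ^ (r ^ 2) / ∏ j ∈ Finset.range r, (1 - q ^ (j + 1)) := by
  rw [← (Nat.cast_injective (R := ℤ)).tsum_eq]
  · refine tsum_congr fun r ↦ ?_
    rw [qFactorialInv_natCast, div_eq_mul_inv]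
    norm_cast
  · intro s hs
    by_contra h
    refine hs ?_
    have hs' : s < 0 := by
      by_contra h'
      exact h ⟨s.toNat, by lia⟩
    simp only [qFactorialInv_of_neg q hs', mul_zero]

theorem prod_range_five_mul (f : ℕ → ℂ) (n : ℕ) :
    ∏ i ∈ Finset.range (5 * n), f i = ∏ i ∈ Finset.range n,
      (f (5 * i) * f (5 * i + 1) * f (5 * i + 2) * f (5 * i + 3) * f (5 * i + 4)) := by
  induction n with
  | zero => simp
  | succ n ih =>
    rw [Finset.prod_range_succ, ← ih, mul_add_one]
    simp only [Finset.prod_range_succ, mul_assoc]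

theorem tprod_one_sub_pow_eq_mul {q : ℂ} (hq : ‖q‖ < 1) :
    ∏' i : ℕ, (1 - q ^ (i + 1)) =
      (∏' i : ℕ, (1 - q ^ (5 * i + 1))) * (∏' i : ℕ, (1 - q ^ (5 * i + 2))) *
        (∏' i : ℕ, (1 - q ^ (5 * i + 3))) * (∏' i : ℕ, (1 - q ^ (5 * i + 4))) *
        ∏' i : ℕ, (1 - q ^ (5 * i + 5)) := by
  have hm (l : ℕ) :=
    (multipliable_one_sub_pow_mul_add hq (k := 5) (by norm_num) l).tendsto_prod_tprod_nat
  have h₁ := (multipliable_one_sub_pow_mul_add hq one_ne_zero 1).tendsto_prod_tprod_nat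
  simp only [one_mul] at h₁
  have h₂ : Tendsto (fun n : ℕ ↦ 5 * n) atTop atTop := tendsto_id.const_mul_atTop' (by norm_num)
  refine tendsto_nhds_unique (h₁.comp h₂)
    ((((((hm 1).mul (hm 2)).mul (hm 3)).mul (hm 4)).mul (hm 5)).congr fun n ↦ ?_)
  simp only [Function.comp_apply, prod_range_five_mul, Finset.prod_mul_distrib, add_assoc,
    Nat.reduceAdd]

theorem rogers_ramanujan_analytic (q : ℂ) (hq : ‖q‖ < 1) :
    Multipliable (fun i : ℕ => (1 - q^(5*i+1))⁻¹ * (1 - q^(5*i+4))⁻¹) ∧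
    (∏' i : ℕ, (1 - q^(5*i+1))⁻¹ * (1 - q^(5*i+4))⁻¹) =
      ∑' r : ℕ, q^(r^2) / ∏ j ∈ Finset.range r, (1 - q^(j+1)) := by
  have hm (l : ℕ) := multipliable_one_sub_pow_mul_add hq (k := 5) (by norm_num) l
  have hne (l : ℕ) (hl : l ≠ 0) :=
    tprod_one_sub_pow_mul_add_ne_zero hq (k := 5) (by norm_num) hl
  have hprod := ((hm 1).hasProd.inv₀ (hne 1 (by norm_num))).mul
    ((hm 4).hasProd.inv₀ (hne 4 (by norm_num)))
  refine ⟨hprod.multipliable, hprod.tprod_eq.trans ?_⟩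
  rcases eq_or_ne q 0 with rfl | hq0
  · rw [tsum_eq_single 0 fun r hr ↦ by simp [hr]]
    simp
  · rw [← tsum_zpow_sq_mul_qFactorialInv_eq_tsum_nat, tsum_zpow_sq_mul_qFactorialInv_eq hq hq0,
      tprod_one_sub_pow_eq_mul hq]
    have h₁ := hne 1 (by norm_num)
    have h₂ := hne 2 (by norm_num)
    have h₃ := hne 3 (by norm_num)
    have h₄ := hne 4 (by norm_num)
    have h₅ := hne 5 (by norm_num)
    field_simp
end
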